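/- arXiv:1705.03987 — 10 statements merged into one kernel-verified Lean document; each statement's English description precedes it below -/
import Mathlib

section
/- For every integer k ≥ 1, the configuration of N = 2k+1 equal masses m_1 = … = m_N = m > 0 placed at the vertices of the regular (2k+1)-gon on the great circle S^1, namely q_i = (cos(2iπ/(2k+1)), sin(2iπ/(2k+1))) for i = 1,…,2k+1, is a special central configuration. -/
open Real Matrix Finset

/-- The reflection `j ↦ 2i - j` of `Fin (n + 1)`, lifted to the integers. -/
lemma Fin.exists_val_add_self_sub {n : ℕ} (i j : Fin (n + 1)) :
    ∃ z : ℤ, (((i + i - j : Fin (n + 1)) : ℕ) : ℤ) = 2 * (i : ℕ) - (j : ℕ) + z * (n + 1) := by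
  have hj : (j : ℕ) ≤ n + 1 := j.isLt.le
  rw [Fin.val_sub, Fin.val_add]
  have h := Nat.mod_add_div (n + 1 - (j : ℕ) + ((i : ℕ) + i) % (n + 1)) (n + 1)
  have h' := Nat.mod_add_div ((i : ℕ) + i) (n + 1)
  zify [hj] at h h' ⊢
  exact ⟨1 - (n + 1 - (j : ℕ) + ((i : ℕ) + (i : ℕ)) % (n + 1)) / (n + 1) -
    ((i : ℕ) + (i : ℕ)) / (n + 1), by linear_combination h + h'⟩

/-- An odd `2π`-periodic function sums to zero over the differences between the vertices
of a regular polygon and a fixed vertex. -/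
lemma sum_odd_periodic_regular_polygon {n : ℕ} (F : ℝ → ℝ) (hodd : F.Odd)
    (hper : Function.Periodic F (2 * π)) (i : Fin (n + 1)) :
    ∑ j : Fin (n + 1), F (2 * π * ((j : ℕ) - (i : ℕ)) / (n + 1)) = 0 := by
  have h : ∑ j : Fin (n + 1), F (2 * π * ((j : ℕ) - (i : ℕ)) / (n + 1)) =
      ∑ j : Fin (n + 1), -F (2 * π * ((j : ℕ) - (i : ℕ)) / (n + 1)) := by
    rw [← Equiv.sum_comp (Equiv.subLeft (i + i))]
    refine Finset.sum_congr rfl fun j _ => ?_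
    obtain ⟨z, hz⟩ := Fin.exists_val_add_self_sub i j
    have hz' : (((i + i - j : Fin (n + 1)) : ℕ) : ℝ) =
        2 * (i : ℕ) - (j : ℕ) + z * (n + 1) := by exact_mod_cast hz
    have hn : (n : ℝ) + 1 ≠ 0 := by positivity
    rw [Equiv.subLeft_apply, hz', ← hodd, ← hper.int_mul z (-_)]
    congr 1
    field_simp
    ring
  rw [Finset.sum_neg_distrib] at h
  linarith

/-- For every k ≥ 1, the 2k+1 equal masses at the vertices of a regular
(2k+1)-gon on the unit circle S¹ ⊂ ℝ² form a special central configuration. -/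
theorem stmt3 (k : ℕ) (hk : 1 ≤ k) (m : ℝ) (hm : 0 < m)
    (q : Fin (2 * k + 1) → Fin 2 → ℝ)
    (hq : ∀ i : Fin (2 * k + 1),
      q i = ![Real.cos (2 * ((i : ℕ) + 1) * Real.pi / (2 * k + 1)),
              Real.sin (2 * ((i : ℕ) + 1) * Real.pi / (2 * k + 1))]) :
    ∀ i, (∑ j ∈ Finset.univ.erase i,
        ((m * m) / (Real.sqrt (1 - (q i ⬝ᵥ q j) ^ 2)) ^ 3) •
          (q j - (q i ⬝ᵥ q j) • q i)) = 0 := by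
  intro i
  let F : ℝ → ℝ := fun d => m * m / √(1 - cos d ^ 2) ^ 3 * sin d
  have hodd : F.Odd := fun d => by simp [F]
  have hper : Function.Periodic F (2 * π) := fun d => by simp [F]
  let a : Fin (2 * k + 1) → ℝ := fun j => 2 * ((j : ℕ) + 1) * π / (2 * k + 1)
  have hqa : ∀ j, q j = ![cos (a j), sin (a j)] := hq
  have hdot : ∀ j, q i ⬝ᵥ q j = cos (a j - a i) := fun j => by
    rw [hqa, hqa, cos_sub]
    simp [dotProduct, Fin.sum_univ_two]
    ring
  have hterm : ∀ j, (m * m / √(1 - (q i ⬝ᵥ q j) ^ 2) ^ 3) • (q j - (q i ⬝ᵥ q j) • q i) =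
      F (a j - a i) • ![-sin (a i), cos (a i)] := fun j => by
    have hvec : q j - cos (a j - a i) • q i = sin (a j - a i) • ![-sin (a i), cos (a i)] := by
      rw [hqa, hqa, cos_sub, sin_sub]
      ext l
      fin_cases l
      · simp
        linear_combination -cos (a j) * sin_sq_add_cos_sq (a i)
      · simp
        linear_combination -sin (a j) * sin_sq_add_cos_sq (a i)
    rw [hdot, hvec, smul_smul]
  have hsum : ∑ j, F (a j - a i) = 0 := by
    rw [← sum_odd_periodic_regular_polygon F hodd hper i]
    refine Finset.sum_congr rfl fun j _ => ?_
    congr 1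
    simp only [a]
    push_cast
    ring
  have hself : F (a i - a i) = 0 := by simp [F]
  rw [Finset.sum_congr rfl fun j _ => hterm j, ← Finset.sum_smul,
    Finset.sum_erase (f := fun j => F (a j - a i)) _ hself, hsum, zero_smul]
end

section
/- Four equal masses m_1 = m_2 = m_3 = m_4 = m > 0 placed at the vertices of a regular tetrahedron inscribed in S^2, i.e. at unit vectors q_1, q_2, q_3, q_4 ∈ ℝ³ with q_i·q_j = −1/3 for all i ≠ j (equivalently q_1 + q_2 + q_3 + q_4 = 0 with all pairwise distances equal), form a special central configuration. -/
open Real Matrix Finset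

/-- The vertices of a regular tetrahedron inscribed in the unit sphere sum to zero. -/
theorem sum_eq_zero_of_dotProduct_eq {n : Type*} [Fintype n] (q : Fin 4 → n → ℝ)
    (hunit : ∀ i, q i ⬝ᵥ q i = 1)
    (hreg : ∀ i j, i ≠ j → q i ⬝ᵥ q j = -(1 / 3)) :
    ∑ i, q i = 0 := by
  have hgram : ∀ i j, q i ⬝ᵥ q j = if i = j then 1 else -(1 / 3) := by
    intro i j
    split_ifs with h
    · rw [h, hunit]
    · exact hreg i j h
  rw [← dotProduct_self_eq_zero]
  simp only [sum_dotProduct, dotProduct_sum]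
  simp only [hgram, Fin.sum_univ_four]
  norm_num [Fin.ext_iff]

/-- Four equal masses at the vertices of a regular tetrahedron inscribed in
S² ⊂ ℝ³ (pairwise inner products −1/3) form a special central configuration. -/
theorem stmt4 (m : ℝ) (hm : 0 < m) (q : Fin 4 → Fin 3 → ℝ)
    (hunit : ∀ i, q i ⬝ᵥ q i = 1)
    (hreg : ∀ i j, i ≠ j → q i ⬝ᵥ q j = -(1 / 3)) :
    ∀ i, (∑ j ∈ Finset.univ.erase i,
        ((m * m) / (Real.sqrt (1 - (q i ⬝ᵥ q j) ^ 2)) ^ 3) •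
          (q j - (q i ⬝ᵥ q j) • q i)) = 0 := by
  intro i
  have hterm : ∀ j ∈ Finset.univ.erase i,
      ((m * m) / (Real.sqrt (1 - (q i ⬝ᵥ q j) ^ 2)) ^ 3) • (q j - (q i ⬝ᵥ q j) • q i) =
        ((m * m) / (Real.sqrt (1 - (-(1 / 3)) ^ 2)) ^ 3) • (q j + (1 / 3 : ℝ) • q i) := by
    intro j hj
    rw [hreg i j (Finset.ne_of_mem_erase hj).symm, neg_smul, sub_neg_eq_add]
  have hsum : ∑ j ∈ Finset.univ.erase i, (q j + (1 / 3 : ℝ) • q i) = ∑ j, q j := by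
    rw [Finset.sum_add_distrib, Finset.sum_const, Finset.card_erase_of_mem (Finset.mem_univ i),
      ← Finset.sum_erase_add _ _ (Finset.mem_univ i), Finset.card_univ, Fintype.card_fin]
    module
  rw [Finset.sum_congr rfl hterm, ← Finset.smul_sum, hsum,
    sum_eq_zero_of_dotProduct_eq q hunit hreg, smul_zero]
end

section
/- Five equal masses m_1 = … = m_5 = m > 0 placed at the vertices of a regular pentatope (regular 4-simplex) inscribed in S^3, i.e. at unit vectors q_1,…,q_5 ∈ ℝ⁴ with q_i·q_j = −1/4 for all i ≠ j (equivalently q_1 + … + q_5 = 0 with all pairwise distances equal), form a special central configuration. -/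
open Real Matrix Finset

/-- The vertices of a regular pentatope inscribed in the unit sphere sum to zero. -/
theorem sum_pentatope_eq_zero (q : Fin 5 → Fin 4 → ℝ)
    (hunit : ∀ i, q i ⬝ᵥ q i = 1)
    (hreg : ∀ i j, i ≠ j → q i ⬝ᵥ q j = -(1 / 4)) :
    ∑ j, q j = 0 := by
  have hrow : ∀ i, q i ⬝ᵥ ∑ j, q j = 0 := by
    intro i
    rw [dotProduct_sum, ← Finset.add_sum_erase _ _ (Finset.mem_univ i), hunit,
      Finset.sum_congr rfl fun j hj => hreg i j (Finset.ne_of_mem_erase hj).symm]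
    norm_num
  rw [← dotProduct_self_eq_zero, sum_dotProduct]
  exact Finset.sum_eq_zero fun i _ => hrow i

/-- Five equal masses at the vertices of a regular pentatope inscribed in
S³ ⊂ ℝ⁴ (pairwise inner products −1/4) form a special central configuration. -/
theorem stmt5 (m : ℝ) (hm : 0 < m) (q : Fin 5 → Fin 4 → ℝ)
    (hunit : ∀ i, q i ⬝ᵥ q i = 1)
    (hreg : ∀ i j, i ≠ j → q i ⬝ᵥ q j = -(1 / 4)) :
    ∀ i, (∑ j ∈ Finset.univ.erase i,
        ((m * m) / (Real.sqrt (1 - (q i ⬝ᵥ q j) ^ 2)) ^ 3) •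
          (q j - (q i ⬝ᵥ q j) • q i)) = 0 := by
  intro i
  have hsum := sum_pentatope_eq_zero q hunit hreg
  rw [← Finset.add_sum_erase _ _ (Finset.mem_univ i)] at hsum
  rw [Finset.sum_congr rfl fun j hj => by rw [hreg i j (Finset.ne_of_mem_erase hj).symm],
    ← Finset.smul_sum, Finset.sum_sub_distrib, eq_neg_of_add_eq_zero_right hsum,
    Finset.sum_const, Finset.card_erase_of_mem (Finset.mem_univ i), Finset.card_univ,
    Fintype.card_fin]
  convert smul_zero _ using 2
  module
end

section
/- For any integers k_1, k_2 ≥ 1 and any masses m > 0 and m̄ > 0, the configuration of N = (2k_1+1) + (2k_2+1) bodies on S^3 obtained by placing 2k_1+1 masses equal to m at the vertices of a regular (2k_1+1)-gon on the circle S^1_{xy} = {(cos φ, sin φ, 0, 0)} (at q_i = (cos(2iπ/(2k_1+1)), sin(2iπ/(2k_1+1)), 0, 0), i = 1,…,2k_1+1) and 2k_2+1 masses equal to m̄ at the vertices of a regular (2k_2+1)-gon on the complementary circle S^1_{zw} = {(0, 0, cos φ, sin φ)} (at q_{2k_1+1+j} = (0, 0, cos(2jπ/(2k_2+1)), sin(2jπ/(2k_2+1))),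 j = 1,…,2k_2+1) is a special central configuration. -/
open Real Matrix Finset

/-- The angle of the `j`-th vertex of a regular `n`-gon, counted from `1`. -/
noncomputable def polygonAngle (n : ℕ) (j : Fin n) : ℝ :=
  2 * ((j : ℕ) + 1) * π / n

/-- The `j`-th vertex of the regular `n`-gon on the unit circle spanned by `u` and `v`. -/
noncomputable def polygonVertex {ι : Type*} (n : ℕ) (u v : ι → ℝ) (j : Fin n) : ι → ℝ :=
  cos (polygonAngle n j) • u + sin (polygonAngle n j) • v

lemma sum_exp_polygonAngle {n : ℕ} (hn : 1 < n) :
    ∑ j : Fin n, Complex.exp (polygonAngle n j * Complex.I) = 0 := by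
  have hn0 : n ≠ 0 := by omega
  have hprim := Complex.isPrimitiveRoot_exp n hn0
  have hterm (j : Fin n) : Complex.exp (polygonAngle n j * Complex.I) =
      Complex.exp (2 * π * Complex.I / n) * Complex.exp (2 * π * Complex.I / n) ^ (j : ℕ) := by
    rw [← pow_succ', ← Complex.exp_nat_mul]
    congr 1
    simp only [polygonAngle]
    push_cast
    ring
  rw [sum_congr rfl fun j _ => hterm j, ← mul_sum,
    Fin.sum_univ_eq_sum_range (fun j => Complex.exp (2 * π * Complex.I / n) ^ j),
    hprim.geom_sum_eq_zero hn, mul_zero]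

lemma sum_cos_polygonAngle {n : ℕ} (hn : 1 < n) : ∑ j : Fin n, cos (polygonAngle n j) = 0 := by
  simpa [Complex.exp_ofReal_mul_I_re] using congrArg Complex.re (sum_exp_polygonAngle hn)

lemma sum_sin_polygonAngle {n : ℕ} (hn : 1 < n) : ∑ j : Fin n, sin (polygonAngle n j) = 0 := by
  simpa [Complex.exp_ofReal_mul_I_im] using congrArg Complex.im (sum_exp_polygonAngle hn)

lemma sum_polygonVertex {ι : Type*} {n : ℕ} (hn : 1 < n) (u v : ι → ℝ) :
    ∑ j, polygonVertex n u v j = 0 := by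
  simp only [polygonVertex, sum_add_distrib, ← sum_smul, sum_cos_polygonAngle hn,
    sum_sin_polygonAngle hn, zero_smul, add_zero]

/-- Reflecting a regular polygon in the line through its `i`-th vertex permutes the vertices. -/
lemma exists_polygonAngle_reflection {n : ℕ} [NeZero n] (i j : Fin n) :
    ∃ k : ℤ, polygonAngle n (i + i - j) - polygonAngle n i =
      -(polygonAngle n j - polygonAngle n i) + k * (2 * π) := by
  have hmod : ((i + i - j : Fin n) : ℤ) ≡ i + i - j [ZMOD n] := by
    rw [Fin.coe_int_sub_eq_mod, Fin.coe_int_add_eq_mod]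
    exact (Int.mod_modEq _ _).trans ((Int.mod_modEq _ _).sub_right _)
  obtain ⟨k, hk⟩ := hmod.symm.dvd
  refine ⟨k, ?_⟩
  have hval : (((i + i - j : Fin n) : ℕ) : ℝ) = i + i - j + n * k := by
    have h : (((i + i - j : Fin n) : ℕ) : ℤ) = i + i - j + n * k := by linarith
    exact_mod_cast h
  have hn0 : (n : ℝ) ≠ 0 := Nat.cast_ne_zero.mpr (NeZero.ne n)
  simp only [polygonAngle, hval]
  field_simp
  ring

/-- A `2π`-periodic odd function sums to zero over the vertices of a regular polygon seen from one
of them. -/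
lemma sum_odd_periodic_polygonAngle {n : ℕ} {F : ℝ → ℝ} (hodd : ∀ t, F (-t) = -F t)
    (hper : Function.Periodic F (2 * π)) (i : Fin n) :
    ∑ j, F (polygonAngle n j - polygonAngle n i) = 0 := by
  have : NeZero n := ⟨by have := i.isLt; omega⟩
  have hneg : ∑ j, F (polygonAngle n j - polygonAngle n i) =
      -∑ j, F (polygonAngle n j - polygonAngle n i) := by
    rw [← sum_neg_distrib, ← (Equiv.subLeft (i + i)).sum_comp]
    refine sum_congr rfl fun j _ => ?_
    obtain ⟨k, hk⟩ := exists_polygonAngle_reflection i j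
    rw [Equiv.subLeft_apply, hk, hper.int_mul k, hodd]
  linarith

lemma polygonVertex_sub_cos_smul {ι : Type*} {n : ℕ} (u v : ι → ℝ) (i j : Fin n) :
    polygonVertex n u v j - cos (polygonAngle n j - polygonAngle n i) • polygonVertex n u v i =
      sin (polygonAngle n j - polygonAngle n i) •
        (cos (polygonAngle n i) • v - sin (polygonAngle n i) • u) := by
  ext x
  simp only [polygonVertex, Pi.add_apply, Pi.sub_apply, Pi.smul_apply, smul_eq_mul, cos_sub,
    sin_sub]
  generalize polygonAngle n i = a
  generalize polygonAngle n j = b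
  linear_combination (-cos b * u x - sin b * v x) * sin_sq_add_cos_sq a

section Orthonormal

variable {ι : Type*} [Fintype ι] {n : ℕ} {u v : ι → ℝ}

lemma polygonVertex_dotProduct (hu : u ⬝ᵥ u = 1) (hv : v ⬝ᵥ v = 1) (huv : u ⬝ᵥ v = 0)
    (i j : Fin n) : polygonVertex n u v i ⬝ᵥ polygonVertex n u v j =
      cos (polygonAngle n j - polygonAngle n i) := by
  have hvu : v ⬝ᵥ u = 0 := by rw [dotProduct_comm, huv]
  simp only [polygonVertex, add_dotProduct, dotProduct_add, smul_dotProduct, dotProduct_smul,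
    hu, hv, huv, hvu, smul_eq_mul, cos_sub]
  ring

/-- The forces exerted on a vertex of a regular polygon by its own polygon cancel. -/
lemma sum_force_own_polygon (hu : u ⬝ᵥ u = 1) (hv : v ⬝ᵥ v = 1) (huv : u ⬝ᵥ v = 0) (c : ℝ)
    (i : Fin n) :
    ∑ j, (c / √(1 - (polygonVertex n u v i ⬝ᵥ polygonVertex n u v j) ^ 2) ^ 3) •
      (polygonVertex n u v j -
        (polygonVertex n u v i ⬝ᵥ polygonVertex n u v j) • polygonVertex n u v i) = 0 := by
  simp only [polygonVertex_dotProduct hu hv huv, polygonVertex_sub_cos_smul, smul_smul,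
    ← sum_smul]
  rw [sum_odd_periodic_polygonAngle (F := fun t => c / √(1 - cos t ^ 2) ^ 3 * sin t)
    (fun t => by simp) (fun t => by simp), zero_smul]

/-- A regular polygon exerts no force on a body lying on the complementary circle. -/
lemma sum_force_complementary_polygon (hn : 1 < n) {x : ι → ℝ} (hxu : x ⬝ᵥ u = 0)
    (hxv : x ⬝ᵥ v = 0) (c : ℝ) :
    ∑ j, (c / √(1 - (x ⬝ᵥ polygonVertex n u v j) ^ 2) ^ 3) •
      (polygonVertex n u v j - (x ⬝ᵥ polygonVertex n u v j) • x) = 0 := by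
  have hx (j : Fin n) : x ⬝ᵥ polygonVertex n u v j = 0 := by
    simp [polygonVertex, dotProduct_add, hxu, hxv]
  simp only [hx, zero_smul, sub_zero, ← smul_sum, sum_polygonVertex hn, smul_zero]

end Orthonormal

/-- 2k₁+1 masses m on a regular (2k₁+1)-gon on the circle S¹_{xy} together with
2k₂+1 masses m̄ on a regular (2k₂+1)-gon on the complementary circle S¹_{zw}
form a special central configuration in S³. -/
theorem stmt6 (k₁ k₂ : ℕ) (hk₁ : 1 ≤ k₁) (hk₂ : 1 ≤ k₂)
    (m mbar : ℝ) (hm : 0 < m) (hmbar : 0 < mbar)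
    (q : Fin (2 * k₁ + 1 + (2 * k₂ + 1)) → Fin 4 → ℝ)
    (hq₁ : ∀ i : Fin (2 * k₁ + 1 + (2 * k₂ + 1)), (i : ℕ) < 2 * k₁ + 1 →
      q i = ![Real.cos (2 * ((i : ℕ) + 1) * Real.pi / (2 * k₁ + 1)),
              Real.sin (2 * ((i : ℕ) + 1) * Real.pi / (2 * k₁ + 1)), 0, 0])
    (hq₂ : ∀ i : Fin (2 * k₁ + 1 + (2 * k₂ + 1)), 2 * k₁ + 1 ≤ (i : ℕ) →
      q i = ![0, 0, Real.cos (2 * ((i : ℕ) - 2 * k₁) * Real.pi / (2 * k₂ + 1)),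
              Real.sin (2 * ((i : ℕ) - 2 * k₁) * Real.pi / (2 * k₂ + 1))])
    (mv : Fin (2 * k₁ + 1 + (2 * k₂ + 1)) → ℝ)
    (hmv₁ : ∀ i : Fin (2 * k₁ + 1 + (2 * k₂ + 1)), (i : ℕ) < 2 * k₁ + 1 → mv i = m)
    (hmv₂ : ∀ i : Fin (2 * k₁ + 1 + (2 * k₂ + 1)), 2 * k₁ + 1 ≤ (i : ℕ) → mv i = mbar) :
    ∀ i, (∑ j ∈ Finset.univ.erase i,
        ((mv i * mv j) / (Real.sqrt (1 - (q i ⬝ᵥ q j) ^ 2)) ^ 3) •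
          (q j - (q i ⬝ᵥ q j) • q i)) = 0 := by
  have hqa (a : Fin (2 * k₁ + 1)) : q (Fin.castAdd _ a) =
      polygonVertex (2 * k₁ + 1) ![1, 0, 0, 0] ![0, 1, 0, 0] a := by
    rw [hq₁ _ a.isLt]
    simp [polygonVertex, polygonAngle]
  have hqb (b : Fin (2 * k₂ + 1)) : q (Fin.natAdd _ b) =
      polygonVertex (2 * k₂ + 1) ![0, 0, 1, 0] ![0, 0, 0, 1] b := by
    have hidx : ((Fin.natAdd (2 * k₁ + 1) b : ℕ) : ℝ) - 2 * k₁ = (b : ℕ) + 1 := by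
      simp only [Fin.val_natAdd]
      push_cast
      ring
    rw [hq₂ _ (by simp), hidx]
    simp [polygonVertex, polygonAngle]
  have hma (a : Fin (2 * k₁ + 1)) : mv (Fin.castAdd _ a) = m := hmv₁ _ a.isLt
  have hmb (b : Fin (2 * k₂ + 1)) : mv (Fin.natAdd _ b) = mbar := hmv₂ _ (by simp)
  intro i
  have hself : q i ⬝ᵥ q i = 1 := by
    induction i using Fin.addCases with
    | left a => rw [hqa, polygonVertex_dotProduct] <;> simp
    | right b => rw [hqb, polygonVertex_dotProduct] <;> simp
  rw [sum_erase _ (by simp [hself]), Fin.sum_univ_add]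
  induction i using Fin.addCases with
  | left a =>
    simp only [hqa, hqb, hma, hmb]
    rw [sum_force_own_polygon, sum_force_complementary_polygon, add_zero] <;>
      first | omega | simp [polygonVertex]
  | right b =>
    simp only [hqa, hqb, hma, hmb]
    rw [sum_force_own_polygon, sum_force_complementary_polygon, add_zero] <;>
      first | omega | simp [polygonVertex]
end

section
/- The mass set M_N is nonempty for every integer N ≥ 3: for every N ≥ 3 there exist positive masses m_1,…,m_N with m_1 + … + m_N = 1 and a nonsingular configuration q = (q_1,…,q_N) on S^3 that is a special central configuration for these masses. -/
open Real Matrix Finset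

/-- A configuration on `S³` which is a special central configuration for equal masses. The sum runs
over all indices, the diagonal term being zero. -/
structure IsEqualMassSCC {ι : Type} [Fintype ι] (q : ι → Fin 4 → ℝ) : Prop where
  unit : ∀ i, q i ⬝ᵥ q i = 1
  nonsingular : ∀ i j, i ≠ j → q i ≠ q j ∧ q i ≠ -q j
  balanced : ∀ i, ∑ j, ((Real.sqrt (1 - (q i ⬝ᵥ q j) ^ 2)) ^ 3)⁻¹ •
    (q j - (q i ⬝ᵥ q j) • q i) = 0

/-- A configuration on the unit circle, with coordinates `(x i, y i)`, which is a special central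
configuration for equal masses and has its centre of mass at the origin. -/
structure IsCenteredCircleSCC {ι : Type} [Fintype ι] (x y : ι → ℝ) : Prop where
  unit : ∀ i, x i * x i + y i * y i = 1
  nonsingular : ∀ i j, i ≠ j → ¬(x i = x j ∧ y i = y j) ∧ ¬(x i = -x j ∧ y i = -y j)
  sum_x : ∑ i, x i = 0
  sum_y : ∑ i, y i = 0
  balanced_x : ∀ i, ∑ j, ((Real.sqrt (1 - (x i * x j + y i * y j) ^ 2)) ^ 3)⁻¹ *
    (x j - (x i * x j + y i * y j) * x i) = 0
  balanced_y : ∀ i, ∑ j, ((Real.sqrt (1 - (x i * x j + y i * y j) ^ 2)) ^ 3)⁻¹ *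
    (y j - (x i * x j + y i * y j) * y i) = 0

theorem IsCenteredCircleSCC.of_isEmpty {ι : Type} [Fintype ι] [IsEmpty ι] (x y : ι → ℝ) :
    IsCenteredCircleSCC x y where
  unit := isEmptyElim
  nonsingular := isEmptyElim
  sum_x := by simp
  sum_y := by simp
  balanced_x := isEmptyElim
  balanced_y := isEmptyElim

/-- The vertices of a regular polygon with an odd number of vertices. -/
theorem isCenteredCircleSCC_zmod (n : ℕ) [NeZero n] (hn : Odd n) (h1 : 1 < n) :
    IsCenteredCircleSCC (fun k : ZMod n => (ZMod.stdAddChar k : ℂ).re)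
      (fun k : ZMod n => (ZMod.stdAddChar k : ℂ).im) := by
  have hnorm (k : ZMod n) : (ZMod.stdAddChar k : ℂ).re * (ZMod.stdAddChar k : ℂ).re
      + (ZMod.stdAddChar k : ℂ).im * (ZMod.stdAddChar k : ℂ).im = 1 := by
    have h : ‖(ZMod.stdAddChar k : ℂ)‖ = 1 := AddChar.norm_apply _ _
    rw [← Complex.normSq_apply, Complex.normSq_eq_norm_sq, h, one_pow]
  have hneg (k : ZMod n) : (ZMod.stdAddChar (-k) : ℂ) =
      (starRingEnd ℂ) (ZMod.stdAddChar k) := by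
    rw [AddChar.map_neg_eq_conj]
  have hre (i k : ZMod n) : (ZMod.stdAddChar (i + k) : ℂ).re =
      (ZMod.stdAddChar i : ℂ).re * (ZMod.stdAddChar k : ℂ).re -
      (ZMod.stdAddChar i : ℂ).im * (ZMod.stdAddChar k : ℂ).im := by
    rw [AddChar.map_add_eq_mul, Complex.mul_re]
  have him (i k : ZMod n) : (ZMod.stdAddChar (i + k) : ℂ).im =
      (ZMod.stdAddChar i : ℂ).re * (ZMod.stdAddChar k : ℂ).im +
      (ZMod.stdAddChar i : ℂ).im * (ZMod.stdAddChar k : ℂ).re := by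
    rw [AddChar.map_add_eq_mul, Complex.mul_im]
  have hdot (i k : ZMod n) :
      (ZMod.stdAddChar i : ℂ).re * (ZMod.stdAddChar (i + k) : ℂ).re +
      (ZMod.stdAddChar i : ℂ).im * (ZMod.stdAddChar (i + k) : ℂ).im =
      (ZMod.stdAddChar k : ℂ).re := by
    rw [hre, him]
    linear_combination (ZMod.stdAddChar k : ℂ).re * hnorm i
  have hsum : ∑ k : ZMod n, (ZMod.stdAddChar k : ℂ) = 0 := by
    apply AddChar.sum_eq_zero_of_ne_one
    intro h
    have h10 : (1 : ZMod n) = 0 := ZMod.injective_stdAddChar (by rw [h]; simp)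
    have : Fact (1 < n) := ⟨h1⟩
    exact one_ne_zero h10
  -- the tangential force is an odd function of the relative position
  have hforce : ∑ k : ZMod n,
      ((Real.sqrt (1 - (ZMod.stdAddChar k : ℂ).re ^ 2)) ^ 3)⁻¹ *
        (ZMod.stdAddChar k : ℂ).im = 0 := by
    have h := Equiv.sum_comp (Equiv.neg (ZMod n)) (fun k : ZMod n =>
      ((Real.sqrt (1 - (ZMod.stdAddChar k : ℂ).re ^ 2)) ^ 3)⁻¹ * (ZMod.stdAddChar k : ℂ).im)
    simp only [Equiv.neg_apply, hneg, Complex.conj_re, Complex.conj_im, mul_neg,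
      Finset.sum_neg_distrib] at h
    linarith
  refine ⟨hnorm, ?_, ?_, ?_, ?_, ?_⟩
  · intro i j hij
    constructor
    · rintro ⟨h₁, h₂⟩
      exact hij (ZMod.injective_stdAddChar (Complex.ext h₁ h₂))
    · rintro ⟨h₁, h₂⟩
      have h : (ZMod.stdAddChar i : ℂ) = -ZMod.stdAddChar j := Complex.ext h₁ h₂
      have h2 : 2 * i = 2 * j := by
        apply ZMod.injective_stdAddChar
        rw [two_mul, two_mul, AddChar.map_add_eq_mul, AddChar.map_add_eq_mul, h, neg_mul_neg]
      have hu : IsUnit ((2 : ℕ) : ZMod n) :=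
        (ZMod.isUnit_iff_coprime 2 n).2 (Nat.coprime_two_left.2 hn)
      exact hij (hu.mul_left_cancel (by exact_mod_cast h2))
  · simpa using congrArg Complex.re hsum
  · simpa using congrArg Complex.im hsum
  · intro i
    rw [← Equiv.sum_comp (Equiv.addLeft i)]
    simp only [Equiv.coe_addLeft, hdot]
    rw [← mul_zero (-(ZMod.stdAddChar i : ℂ).im), ← hforce, Finset.mul_sum]
    refine Finset.sum_congr rfl fun k _ => ?_
    rw [hre]
    ring
  · intro i
    rw [← Equiv.sum_comp (Equiv.addLeft i)]
    simp only [Equiv.coe_addLeft, hdot]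
    rw [← mul_zero (ZMod.stdAddChar i : ℂ).re, ← hforce, Finset.mul_sum]
    refine Finset.sum_congr rfl fun k _ => ?_
    rw [him]
    ring

/-- Two centred configurations on orthogonal great circles of `S³` form a special central
configuration. -/
theorem IsCenteredCircleSCC.join {α β : Type} [Fintype α] [Fintype β] {x y : α → ℝ}
    {u v : β → ℝ} (h : IsCenteredCircleSCC x y) (h' : IsCenteredCircleSCC u v) :
    IsEqualMassSCC (Sum.elim (fun a => ![x a, y a, 0, 0]) (fun b => ![0, 0, u b, v b])) where
  unit := by
    rintro (a | b)
    · simpa [dotProduct, Fin.sum_univ_four] using h.unit a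
    · simpa [dotProduct, Fin.sum_univ_four] using h'.unit b
  nonsingular := by
    rintro (a | b) (c | d) hij
    · have := h.nonsingular a c (by rintro rfl; exact hij rfl)
      simpa [funext_iff, Fin.forall_fin_succ] using this
    · have hu := h.unit a
      constructor <;> intro h0 <;> simp [funext_iff, Fin.forall_fin_succ] at h0 <;>
        simp [h0.1, h0.2.1] at hu
    · have hu := h'.unit b
      constructor <;> intro h0 <;> simp [funext_iff, Fin.forall_fin_succ] at h0 <;>
        simp [h0.2.2.1, h0.2.2.2] at hu
    · have := h'.nonsingular b d (by rintro rfl; exact hij rfl)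
      simpa [funext_iff, Fin.forall_fin_succ] using this
  balanced := by
    rintro (a | b) <;> ext k <;> fin_cases k
    · simpa [dotProduct, Fin.sum_univ_four] using h.balanced_x a
    · simpa [dotProduct, Fin.sum_univ_four] using h.balanced_y a
    · simpa [dotProduct, Fin.sum_univ_four] using h'.sum_x
    · simpa [dotProduct, Fin.sum_univ_four] using h'.sum_y
    · simpa [dotProduct, Fin.sum_univ_four] using h.sum_x
    · simpa [dotProduct, Fin.sum_univ_four] using h.sum_y
    · simpa [dotProduct, Fin.sum_univ_four] using h'.balanced_x b
    · simpa [dotProduct, Fin.sum_univ_four] using h'.balanced_y b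

/-- The regular tetrahedron in a great two-sphere. -/
theorem isEqualMassSCC_tetrahedron :
    IsEqualMassSCC (![![1, 0, 0, 0], ![-1 / 3, 0, 2 / 3, -2 / 3], ![-1 / 3, -2 / 3, 0, 2 / 3],
      ![-1 / 3, 2 / 3, -2 / 3, 0]] : Fin 4 → Fin 4 → ℝ) where
  unit := by
    intro i
    fin_cases i <;> simp [dotProduct, Fin.sum_univ_four] <;> norm_num
  nonsingular := by
    intro i j hij
    fin_cases i <;> fin_cases j <;> first
      | exact absurd rfl hij
      | (constructor <;> intro h0 <;>
          have h := And.intro (congrFun h0 0) (And.intro (congrFun h0 1) (congrFun h0 2)) <;>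
          norm_num at h)
  balanced := by
    intro i
    ext k
    fin_cases i <;> fin_cases k <;> simp [dotProduct, Fin.sum_univ_four] <;> norm_num <;> ring

/-- An equal mass configuration indexed by a type with `N` elements gives a special central
configuration of `N` bodies. -/
theorem IsEqualMassSCC.exists_fin {ι : Type} [Fintype ι] {q : ι → Fin 4 → ℝ}
    (h : IsEqualMassSCC q) {N : ℕ} (hN : 0 < N) (hcard : Fintype.card ι = N) :
    ∃ m : Fin N → ℝ, (∀ i, 0 < m i) ∧ (∑ i, m i) = 1 ∧
      ∃ q : Fin N → Fin 4 → ℝ,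
        (∀ i, q i ⬝ᵥ q i = 1) ∧
        (∀ i j, i ≠ j → q i ≠ q j ∧ q i ≠ -q j) ∧
        ∀ i, (∑ j ∈ Finset.univ.erase i,
            ((m i * m j) / (Real.sqrt (1 - (q i ⬝ᵥ q j) ^ 2)) ^ 3) •
              (q j - (q i ⬝ᵥ q j) • q i)) = 0 := by
  have hN' : (0 : ℝ) < N := by exact_mod_cast hN
  let e : Fin N ≃ ι := (Fintype.equivFinOfCardEq hcard).symm
  refine ⟨fun _ => (N : ℝ)⁻¹, fun _ => by positivity, by simp [hN'.ne'], q ∘ e,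
    fun i => h.unit _, fun i j hij => h.nonsingular _ _ (e.injective.ne hij), fun i => ?_⟩
  have hb := h.balanced (e i)
  rw [← Equiv.sum_comp e] at hb
  rw [Finset.sum_erase _ (by simp [h.unit]), ← smul_zero ((N : ℝ)⁻¹ * (N : ℝ)⁻¹), ← hb,
    Finset.smul_sum]
  refine Finset.sum_congr rfl fun j _ => ?_
  rw [smul_smul, div_eq_mul_inv]
  rfl

/-- The mass set M_N is nonempty for every N ≥ 3: there exist positive masses
summing to 1 together with a nonsingular special central configuration on S³. -/
theorem stmt7 (N : ℕ) (hN : 3 ≤ N) :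
    ∃ m : Fin N → ℝ, (∀ i, 0 < m i) ∧ (∑ i, m i) = 1 ∧
      ∃ q : Fin N → Fin 4 → ℝ,
        (∀ i, q i ⬝ᵥ q i = 1) ∧
        (∀ i j, i ≠ j → q i ≠ q j ∧ q i ≠ -q j) ∧
        ∀ i, (∑ j ∈ Finset.univ.erase i,
            ((m i * m j) / (Real.sqrt (1 - (q i ⬝ᵥ q j) ^ 2)) ^ 3) •
              (q j - (q i ⬝ᵥ q j) • q i)) = 0 := by
  have : NeZero N := ⟨by omega⟩
  rcases Nat.even_or_odd N with he | ho
  · rcases eq_or_ne N 4 with rfl | h4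
    · exact isEqualMassSCC_tetrahedron.exists_fin (by norm_num) (by simp)
    · obtain ⟨k, hk⟩ := he
      have : NeZero (N - 3) := ⟨by omega⟩
      refine ((isCenteredCircleSCC_zmod 3 (by decide) (by norm_num)).join
        (isCenteredCircleSCC_zmod (N - 3) ⟨k - 2, by omega⟩ (by omega))).exists_fin
        (by omega) ?_
      rw [Fintype.card_sum, ZMod.card, ZMod.card]
      omega
  · exact ((isCenteredCircleSCC_zmod N ho (by omega)).join
      (IsCenteredCircleSCC.of_isEmpty (ι := Empty) isEmptyElim isEmptyElim)).exists_fin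
      (by omega) (by simp [ZMod.card])
end

section
/- Let q = (q_1,…,q_N) be a nonsingular Dziobek configuration on S^{N−2}, i.e. q_1,…,q_N are unit vectors in ℝ^{N−1} spanning ℝ^{N−1} with q_i ≠ ±q_j for i ≠ j, and let m_1,…,m_N be positive masses. Set S_ij = 1/sin³(d_ij) for i ≠ j and let Δ = (Δ_1,…,Δ_N) with Δ_k = (−1)^{k+1} det(X_k). Then q is a special central configuration if and only if there exists a real number k ≠ 0 such that m_i m_j S_ij = k Δ_i Δ_j for all i ≠ j. -/
open Real Matrix Finset

/-- Non-parallel unit vectors have inner product strictly between `-1` and `1`. -/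
theorem dotProduct_sq_lt_one {ι : Type*} [Fintype ι] {u v : ι → ℝ}
    (hu : u ⬝ᵥ u = 1) (hv : v ⬝ᵥ v = 1) (h₁ : u ≠ v) (h₂ : u ≠ -v) : (u ⬝ᵥ v) ^ 2 < 1 := by
  have hsub : 0 < (u - v) ⬝ᵥ (u - v) :=
    lt_of_le_of_ne (Finset.sum_nonneg fun i _ => mul_self_nonneg _)
      fun h => h₁ (sub_eq_zero.mp (dotProduct_self_eq_zero.mp h.symm))
  have hadd : 0 < (u + v) ⬝ᵥ (u + v) :=
    lt_of_le_of_ne (Finset.sum_nonneg fun i _ => mul_self_nonneg _)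
      fun h => h₂ (eq_neg_of_add_eq_zero_left (dotProduct_self_eq_zero.mp h.symm))
  simp only [sub_dotProduct, dotProduct_sub, add_dotProduct, dotProduct_add, hu, hv,
    dotProduct_comm v u] at hsub hadd
  nlinarith

/-- The vector of signed maximal minors of an `(n+1) × (n+2)` matrix. -/
def signedMinors {n : ℕ} (X : Matrix (Fin (n + 1)) (Fin (n + 2)) ℝ) (k : Fin (n + 2)) : ℝ :=
  (-1) ^ (k : ℕ) * (X.submatrix id (Fin.succAbove k)).det

theorem mulVec_signedMinors {n : ℕ} (X : Matrix (Fin (n + 1)) (Fin (n + 2)) ℝ) :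
    X *ᵥ signedMinors X = 0 := by
  funext r
  have h : (X.submatrix (Fin.cons r id : Fin (n + 2) → Fin (n + 1)) id).det = 0 :=
    det_zero_of_row_eq (Fin.succ_ne_zero r).symm (by ext; simp)
  rw [det_succ_row_zero] at h
  rw [Pi.zero_apply, ← h, mulVec, dotProduct]
  refine Finset.sum_congr rfl fun k _ => ?_
  rw [submatrix_submatrix, submatrix_apply, Fin.cons_zero, id, signedMinors]
  have hcomp : (Fin.cons r id : Fin (n + 2) → Fin (n + 1)) ∘ Fin.succ = id := by
    ext; simp
  rw [hcomp, Function.id_comp]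
  ring

theorem mulVec_eq_sum_smul_col {ι κ : Type*} [Fintype κ] (X : Matrix ι κ ℝ) (v : κ → ℝ) :
    X *ᵥ v = ∑ j, v j • X.col j := by
  funext r
  simp [mulVec, dotProduct, mul_comm]

theorem signedMinors_ne_zero {n : ℕ} {X : Matrix (Fin (n + 1)) (Fin (n + 2)) ℝ}
    (hspan : Submodule.span ℝ (Set.range X.col) = ⊤) {v : Fin (n + 2) → ℝ} (hv : X *ᵥ v = 0)
    {k : Fin (n + 2)} (hk : v k ≠ 0) : signedMinors X k ≠ 0 := by
  have hsum : v k • X.col k + ∑ j, v (k.succAbove j) • X.col (k.succAbove j) = 0 := by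
    rw [← Fin.sum_univ_succAbove (fun j => v j • X.col j) k, ← hv,
      mulVec_eq_sum_smul_col]
  have hmem : X.col k ∈ Submodule.span ℝ (Set.range fun j => X.col (k.succAbove j)) := by
    rw [← Submodule.smul_mem_iff _ hk, eq_neg_of_add_eq_zero_left hsum]
    exact neg_mem (Submodule.sum_mem _ fun j _ =>
      Submodule.smul_mem _ _ (Submodule.subset_span ⟨j, rfl⟩))
  have htop : ⊤ ≤ Submodule.span ℝ (Set.range fun j => X.col (k.succAbove j)) := by
    rw [← hspan, Submodule.span_le]
    rintro _ ⟨j, rfl⟩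
    rcases Fin.eq_self_or_eq_succAbove k j with rfl | ⟨l, rfl⟩
    · exact hmem
    · exact Submodule.subset_span ⟨l, rfl⟩
  have hli : LinearIndependent ℝ (X.submatrix id k.succAbove).col :=
    linearIndependent_of_top_le_span_of_card_eq_finrank htop (by simp)
  have hunit := linearIndependent_cols_iff_isUnit.mp hli
  exact mul_ne_zero (pow_ne_zero _ (by norm_num))
    ((isUnit_iff_isUnit_det _).mp hunit).ne_zero

theorem eq_zero_of_mulVec_eq_zero_of_signedMinors_ne_zero {n : ℕ}
    {X : Matrix (Fin (n + 1)) (Fin (n + 2)) ℝ} {k : Fin (n + 2)} (hk : signedMinors X k ≠ 0)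
    {u : Fin (n + 2) → ℝ} (hu : X *ᵥ u = 0) (huk : u k = 0) : u = 0 := by
  have h : X.submatrix id k.succAbove *ᵥ (fun j => u (k.succAbove j)) = 0 := by
    funext r
    have := congrFun hu r
    rw [mulVec, dotProduct, Fin.sum_univ_succAbove _ k, huk, mul_zero, zero_add] at this
    exact this
  have h0 := eq_zero_of_mulVec_eq_zero (right_ne_zero_of_mul hk) h
  funext j
  rcases Fin.eq_self_or_eq_succAbove k j with rfl | ⟨l, rfl⟩
  · exact huk
  · exact congrFun h0 l

/-- A kernel vector is proportional to the vector of signed maximal minors. -/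
theorem mul_signedMinors_eq {n : ℕ} {X : Matrix (Fin (n + 1)) (Fin (n + 2)) ℝ}
    {k : Fin (n + 2)} (hk : signedMinors X k ≠ 0) {v : Fin (n + 2) → ℝ} (hv : X *ᵥ v = 0)
    (j : Fin (n + 2)) : v j * signedMinors X k = v k * signedMinors X j := by
  have h := eq_zero_of_mulVec_eq_zero_of_signedMinors_ne_zero hk
    (u := signedMinors X k • v - v k • signedMinors X)
    (by rw [mulVec_sub, mulVec_smul, mulVec_smul, hv, mulVec_signedMinors]; simp)
    (by simp [mul_comm])
  have hj := congrFun h j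
  simp only [Pi.sub_apply, Pi.smul_apply, smul_eq_mul, Pi.zero_apply] at hj
  linarith

/-- Criterion for Dziobek special central configurations: a nonsingular
configuration of N = n+2 bodies spanning ℝ^{N-1} is a special central
configuration iff m_i m_j S_ij = k Δ_i Δ_j for some k ≠ 0 and all i ≠ j. -/
theorem stmt10 {n : ℕ} (m : Fin (n + 2) → ℝ) (q : Fin (n + 2) → Fin (n + 1) → ℝ)
    (hm : ∀ i, 0 < m i)
    (hunit : ∀ i, q i ⬝ᵥ q i = 1)
    (hns : ∀ i j, i ≠ j → q i ≠ q j ∧ q i ≠ -q j)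
    (hspan : Submodule.span ℝ (Set.range q) = ⊤)
    (X : Matrix (Fin (n + 1)) (Fin (n + 2)) ℝ)
    (hX : ∀ r c, X r c = q c r)
    (Δ : Fin (n + 2) → ℝ)
    (hΔ : ∀ k, Δ k = (-1) ^ (k : ℕ) * (X.submatrix id (Fin.succAbove k)).det) :
    (∀ i, (∑ j ∈ Finset.univ.erase i,
        ((m i * m j) / (Real.sqrt (1 - (q i ⬝ᵥ q j) ^ 2)) ^ 3) •
          (q j - (q i ⬝ᵥ q j) • q i)) = 0) ↔
      ∃ k : ℝ, k ≠ 0 ∧ ∀ i j, i ≠ j →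
        m i * m j * (1 / (Real.sqrt (1 - (q i ⬝ᵥ q j) ^ 2)) ^ 3) = k * Δ i * Δ j := by
  obtain rfl : Δ = signedMinors X := funext hΔ
  have hcol : X.col = q := by
    funext c r
    exact hX r c
  have hker : ∀ v : Fin (n + 2) → ℝ, X *ᵥ v = ∑ j, v j • q j := fun v => by
    rw [mulVec_eq_sum_smul_col, hcol]
  constructor
  · intro h
    set w : Fin (n + 2) → Fin (n + 2) → ℝ :=
      fun i j => (m i * m j) / (Real.sqrt (1 - (q i ⬝ᵥ q j) ^ 2)) ^ 3 with hw
    have hsymm : ∀ i j, w i j = w j i := fun i j => by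
      simp only [hw, dotProduct_comm (q i) (q j), mul_comm (m i)]
    have hpos : ∀ i j, i ≠ j → w i j ≠ 0 := fun i j hij => by
      have := dotProduct_sq_lt_one (hunit i) (hunit j) (hns i j hij).1 (hns i j hij).2
      have hs : 0 < Real.sqrt (1 - (q i ⬝ᵥ q j) ^ 2) := Real.sqrt_pos.mpr (by linarith)
      have := hm i
      have := hm j
      exact ne_of_gt (by positivity)
    have hrow : ∀ i, X *ᵥ (Function.update (w i) i
        (-∑ j ∈ Finset.univ.erase i, w i j * (q i ⬝ᵥ q j))) = 0 := fun i => by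
      rw [hker, ← Finset.add_sum_erase _ _ (Finset.mem_univ i), Function.update_self, ← h i]
      have hoff : ∀ a, ∑ j ∈ Finset.univ.erase i, Function.update (w i) i a j • q j =
          ∑ j ∈ Finset.univ.erase i, w i j • q j := fun a =>
        Finset.sum_congr rfl fun j hj => by
          rw [Function.update_of_ne (Finset.ne_of_mem_erase hj)]
      simp only [hoff, smul_sub, Finset.sum_sub_distrib, smul_smul, ← Finset.sum_smul, neg_smul]
      exact neg_add_eq_sub _ _
    have hΔ0 : ∀ k, signedMinors X k ≠ 0 := fun k => by
      obtain ⟨i, hi⟩ := exists_ne k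
      refine signedMinors_ne_zero (by rw [hcol]; exact hspan) (hrow i) (k := k) ?_
      rw [Function.update_of_ne hi.symm]
      exact hpos i k hi
    set a : Fin (n + 2) → ℝ := fun i => (Function.update (w i) i
        (-∑ j ∈ Finset.univ.erase i, w i j * (q i ⬝ᵥ q j))) 0 / signedMinors X 0 with ha
    have hwa : ∀ i j, i ≠ j → w i j = a i * signedMinors X j := fun i j hij => by
      have := mul_signedMinors_eq (hΔ0 0) (hrow i) j
      rw [Function.update_of_ne hij.symm] at this
      rw [ha, div_mul_eq_mul_div, eq_div_iff (hΔ0 0), this]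
    have hak : ∀ i, a i = a 0 / signedMinors X 0 * signedMinors X i := fun i => by
      rcases eq_or_ne i 0 with rfl | hi
      · rw [div_mul_cancel₀ _ (hΔ0 0)]
      · rw [div_mul_eq_mul_div, eq_div_iff (hΔ0 0), ← hwa i 0 hi, ← hwa 0 i hi.symm, hsymm]
    refine ⟨a 0 / signedMinors X 0, fun h0 => ?_, fun i j hij => ?_⟩
    · refine hpos 0 1 (by simp) ?_
      rw [hwa 0 1 (by simp), hak 0, h0, zero_mul, zero_mul]
    · rw [mul_one_div, ← hak i, ← hwa i j hij]
  · rintro ⟨k, -, hk⟩ i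
    have hz : ∑ j, signedMinors X j • q j = 0 := by rw [← hker, mulVec_signedMinors]
    have hterm : ∀ j ∈ Finset.univ.erase i,
        ((m i * m j) / (Real.sqrt (1 - (q i ⬝ᵥ q j) ^ 2)) ^ 3) • (q j - (q i ⬝ᵥ q j) • q i) =
        (k * signedMinors X i * signedMinors X j) • (q j - (q i ⬝ᵥ q j) • q i) := fun j hj => by
      rw [← hk i j (Finset.ne_of_mem_erase hj).symm, mul_one_div]
    rw [Finset.sum_congr rfl hterm, Finset.sum_erase _ (by simp [hunit i])]
    have hdot : ∑ j, signedMinors X j * (q i ⬝ᵥ q j) = 0 := by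
      have := congrArg (fun x => q i ⬝ᵥ x) hz
      simpa [dotProduct_sum, dotProduct_smul] using this
    simp only [mul_smul, ← Finset.smul_sum, smul_sub, Finset.sum_sub_distrib, hz]
    simp only [smul_smul, ← Finset.sum_smul, hdot]
    simp
end

section
/- Consider three positive masses m_1, m_2, m_3 and a nonsingular configuration q = (q_1, q_2, q_3) on the unit circle S^1 ⊂ ℝ², and set Δ_1 = det[q_2, q_3], Δ_2 = −det[q_1, q_3], Δ_3 = det[q_1, q_2]. Then q is a special central configuration if and only if q_1, q_2, q_3 do not all lie in a common closed semicircle (i.e. there is no unit vector u ∈ ℝ² with u·q_i ≥ 0 for all i) and the mass vector satisfies (m_1, m_2, m_3) = ( (sin³d_12 · Δ_1)/(sin³d_23 · Δ_3), (sin³d_12 · Δ_2)/(sin³d_13 · Δ_3), 1 ) · m_3. -/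
open Real Matrix Finset

/-- The oriented area `det [p, q]` of two vectors of the plane. -/
def planarDet (p q : Fin 2 → ℝ) : ℝ := p 0 * q 1 - p 1 * q 0

theorem planarDet_swap (p q : Fin 2 → ℝ) : planarDet q p = -planarDet p q := by
  unfold planarDet; ring

theorem one_sub_dotProduct_sq {p q : Fin 2 → ℝ} (hp : p ⬝ᵥ p = 1) (hq : q ⬝ᵥ q = 1) :
    1 - (p ⬝ᵥ q) ^ 2 = planarDet p q ^ 2 := by
  simp only [dotProduct, Fin.sum_univ_two, planarDet] at *
  linear_combination (-(q 0 * q 0 + q 1 * q 1)) * hp - hq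

theorem sqrt_one_sub_dotProduct_sq {p q : Fin 2 → ℝ} (hp : p ⬝ᵥ p = 1) (hq : q ⬝ᵥ q = 1) :
    √(1 - (p ⬝ᵥ q) ^ 2) = |planarDet p q| := by
  rw [one_sub_dotProduct_sq hp hq, Real.sqrt_sq_eq_abs]

/-- The component of `q` tangent to the circle at `p` is a multiple of `p` rotated by `π / 2`. -/
theorem sub_dotProduct_smul_eq {p q : Fin 2 → ℝ} (hp : p ⬝ᵥ p = 1) :
    q - (p ⬝ᵥ q) • p = planarDet p q • ![-p 1, p 0] := by
  simp only [dotProduct, Fin.sum_univ_two] at hp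
  ext k
  fin_cases k <;> simp [dotProduct, Fin.sum_univ_two, planarDet]
  · linear_combination (-q 0) * hp
  · linear_combination (-q 1) * hp

theorem planarDet_ne_zero {p q : Fin 2 → ℝ} (hp : p ⬝ᵥ p = 1) (hq : q ⬝ᵥ q = 1)
    (h₁ : p ≠ q) (h₂ : p ≠ -q) : planarDet p q ≠ 0 := by
  intro h
  have hs := one_sub_dotProduct_sq hp hq
  have ht := sub_dotProduct_smul_eq (q := q) hp
  rw [h, zero_smul, sub_eq_zero] at ht
  have hc : (p ⬝ᵥ q) ^ 2 = 1 := by rw [h] at hs; linarith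
  rcases eq_or_eq_neg_of_sq_eq_sq (p ⬝ᵥ q) 1 (by rw [hc, one_pow]) with hc | hc
  · rw [hc, one_smul] at ht
    exact h₁ ht.symm
  · rw [hc, neg_one_smul] at ht
    exact h₂ (by rw [ht, neg_neg])

theorem rotate_ne_zero {p : Fin 2 → ℝ} (hp : p ⬝ᵥ p = 1) : ![-p 1, p 0] ≠ 0 := by
  intro h
  have h0 := congrFun h 0
  have h1 := congrFun h 1
  simp at h0 h1
  simp [dotProduct, Fin.sum_univ_two, h0, h1] at hp

/-- Vanishing of the total force on the body `p` exerted by the bodies `q` and `r`. -/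
theorem force_eq_zero_iff {p q r : Fin 2 → ℝ} (hp : p ⬝ᵥ p = 1) (hq : q ⬝ᵥ q = 1)
    (hr : r ⬝ᵥ r = 1) {a b c : ℝ} (ha : a ≠ 0) :
    (a * b / √(1 - (p ⬝ᵥ q) ^ 2) ^ 3) • (q - (p ⬝ᵥ q) • p) +
      (a * c / √(1 - (p ⬝ᵥ r) ^ 2) ^ 3) • (r - (p ⬝ᵥ r) • p) = 0 ↔
    b * (planarDet p q / |planarDet p q| ^ 3) + c * (planarDet p r / |planarDet p r| ^ 3) = 0 := by
  rw [sqrt_one_sub_dotProduct_sq hp hq, sqrt_one_sub_dotProduct_sq hp hr,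
    sub_dotProduct_smul_eq hp, sub_dotProduct_smul_eq hp, smul_smul, smul_smul, ← add_smul,
    smul_eq_zero, or_iff_left (rotate_ne_zero hp)]
  rw [← or_iff_right (a := a = 0) (b := b * _ + _ = 0) ha, ← mul_eq_zero]
  ring_nf

theorem eq_div_mul_iff_mul_div_abs_cube {x y a c : ℝ} (ha : a ≠ 0) (hc : c ≠ 0) :
    x = |c| ^ 3 * a / (|a| ^ 3 * c) * y ↔ x * (c / |c| ^ 3) = y * (a / |a| ^ 3) := by
  have ha' := abs_ne_zero.mpr ha
  have hc' := abs_ne_zero.mpr hc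
  field_simp

theorem mul_pos_of_mul_div_abs_cube {x y a c : ℝ} (hx : 0 < x) (hy : 0 < y) (ha : a ≠ 0)
    (hc : c ≠ 0) (h : x * (c / |c| ^ 3) = y * (a / |a| ^ 3)) : 0 < a * c := by
  have ha' := abs_pos.mpr ha
  have hc' := abs_pos.mpr hc
  have key : a * c = c ^ 2 * (x * |a| ^ 3 / (y * |c| ^ 3)) := by
    field_simp at h ⊢
    linear_combination -h
  rw [key]
  positivity

theorem planarDet_smul_add_eq_zero (p q r u : Fin 2 → ℝ) :
    planarDet q r * (u ⬝ᵥ p) + planarDet r p * (u ⬝ᵥ q) + planarDet p q * (u ⬝ᵥ r) = 0 := by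
  simp only [dotProduct, Fin.sum_univ_two, planarDet]; ring

/-- If consecutive oriented areas all have the same sign, then the three vectors lie in no
common closed half-plane. -/
theorem not_exists_closed_semicircle {p q r : Fin 2 → ℝ}
    (hac : 0 < planarDet q r * planarDet p q) (hbc : 0 < planarDet r p * planarDet p q)
    {u : Fin 2 → ℝ} (hu : u ⬝ᵥ u = 1) (hup : 0 ≤ u ⬝ᵥ p) (huq : 0 ≤ u ⬝ᵥ q)
    (hur : 0 ≤ u ⬝ᵥ r) : False := by
  have hc : planarDet p q ≠ 0 := right_ne_zero_of_mul hac.ne'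
  have key := planarDet_smul_add_eq_zero p q r u
  have h1 := mul_nonneg hac.le hup
  have h2 := mul_nonneg hbc.le huq
  have h3 := mul_nonneg (sq_nonneg (planarDet p q)) hur
  have hsum : planarDet q r * planarDet p q * (u ⬝ᵥ p) +
      planarDet r p * planarDet p q * (u ⬝ᵥ q) + planarDet p q ^ 2 * (u ⬝ᵥ r) = 0 := by
    linear_combination planarDet p q * key
  have hp : u ⬝ᵥ p = 0 :=
    (mul_eq_zero.mp (by linarith : planarDet q r * planarDet p q * (u ⬝ᵥ p) = 0)).resolve_left
      hac.ne'
  have hq : u ⬝ᵥ q = 0 :=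
    (mul_eq_zero.mp (by linarith : planarDet r p * planarDet p q * (u ⬝ᵥ q) = 0)).resolve_left
      hbc.ne'
  simp only [dotProduct, Fin.sum_univ_two] at hu hp hq
  have h0 : u 0 = 0 := by
    refine (mul_eq_zero.mp ?_).resolve_left hc
    unfold planarDet
    linear_combination q 1 * hp - p 1 * hq
  have h1 : u 1 = 0 := by
    refine (mul_eq_zero.mp ?_).resolve_left hc
    unfold planarDet
    linear_combination p 0 * hq - q 0 * hp
  simp [h0, h1] at hu

/-- Criterion for 3-body special central configurations on S¹: q is an SCC iff
the bodies do not lie in a common closed semicircle and the masses are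
proportional to (sin³d₁₂ Δ₁ / (sin³d₂₃ Δ₃), sin³d₁₂ Δ₂ / (sin³d₁₃ Δ₃), 1)·m₃.
Bodies are indexed 0,1,2. -/
theorem stmt14 (m : Fin 3 → ℝ) (q : Fin 3 → Fin 2 → ℝ)
    (hm : ∀ i, 0 < m i)
    (hunit : ∀ i, q i ⬝ᵥ q i = 1)
    (hns : ∀ i j, i ≠ j → q i ≠ q j ∧ q i ≠ -q j)
    (Δ : Fin 3 → ℝ)
    (hΔ0 : Δ 0 = q 1 0 * q 2 1 - q 1 1 * q 2 0)
    (hΔ1 : Δ 1 = -(q 0 0 * q 2 1 - q 0 1 * q 2 0))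
    (hΔ2 : Δ 2 = q 0 0 * q 1 1 - q 0 1 * q 1 0) :
    (∀ i, (∑ j ∈ Finset.univ.erase i,
        ((m i * m j) / (Real.sqrt (1 - (q i ⬝ᵥ q j) ^ 2)) ^ 3) •
          (q j - (q i ⬝ᵥ q j) • q i)) = 0) ↔
      ((¬ ∃ u : Fin 2 → ℝ, u ⬝ᵥ u = 1 ∧ ∀ i, 0 ≤ u ⬝ᵥ q i) ∧
        m 0 = (Real.sqrt (1 - (q 0 ⬝ᵥ q 1) ^ 2)) ^ 3 * Δ 0 /
                ((Real.sqrt (1 - (q 1 ⬝ᵥ q 2) ^ 2)) ^ 3 * Δ 2) * m 2 ∧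
        m 1 = (Real.sqrt (1 - (q 0 ⬝ᵥ q 1) ^ 2)) ^ 3 * Δ 1 /
                ((Real.sqrt (1 - (q 0 ⬝ᵥ q 2) ^ 2)) ^ 3 * Δ 2) * m 2) := by
  have ha : planarDet (q 1) (q 2) ≠ 0 :=
    planarDet_ne_zero (hunit 1) (hunit 2) (hns 1 2 (by decide)).1 (hns 1 2 (by decide)).2
  have hb : planarDet (q 2) (q 0) ≠ 0 :=
    planarDet_ne_zero (hunit 2) (hunit 0) (hns 2 0 (by decide)).1 (hns 2 0 (by decide)).2
  have hc : planarDet (q 0) (q 1) ≠ 0 :=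
    planarDet_ne_zero (hunit 0) (hunit 1) (hns 0 1 (by decide)).1 (hns 0 1 (by decide)).2
  have hΔa : Δ 0 = planarDet (q 1) (q 2) := hΔ0
  have hΔb : Δ 1 = planarDet (q 2) (q 0) := by rw [hΔ1, planarDet]; ring
  have hΔc : Δ 2 = planarDet (q 0) (q 1) := hΔ2
  have e0 : (univ : Finset (Fin 3)).erase 0 = {1, 2} := by decide
  have e1 : (univ : Finset (Fin 3)).erase 1 = {0, 2} := by decide
  have e2 : (univ : Finset (Fin 3)).erase 2 = {0, 1} := by decide
  rw [Fin.forall_fin_succ, Fin.forall_fin_two]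
  simp only [Fin.succ_zero_eq_one, Fin.succ_one_eq_two]
  rw [e0, e1, e2, sum_pair (by decide), sum_pair (by decide), sum_pair (by decide),
    force_eq_zero_iff (hunit 0) (hunit 1) (hunit 2) (hm 0).ne',
    force_eq_zero_iff (hunit 1) (hunit 0) (hunit 2) (hm 1).ne',
    force_eq_zero_iff (hunit 2) (hunit 0) (hunit 1) (hm 2).ne',
    sqrt_one_sub_dotProduct_sq (hunit 0) (hunit 1), sqrt_one_sub_dotProduct_sq (hunit 1) (hunit 2),
    sqrt_one_sub_dotProduct_sq (hunit 0) (hunit 2), hΔa, hΔb, hΔc,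
    planarDet_swap (q 2) (q 0), planarDet_swap (q 0) (q 1), planarDet_swap (q 1) (q 2)]
  simp only [abs_neg, neg_div]
  rw [eq_div_mul_iff_mul_div_abs_cube ha hc, eq_div_mul_iff_mul_div_abs_cube hb hc]
  constructor
  · rintro ⟨h0, h1, -⟩
    have hm0 : m 0 * (planarDet (q 0) (q 1) / |planarDet (q 0) (q 1)| ^ 3) =
        m 2 * (planarDet (q 1) (q 2) / |planarDet (q 1) (q 2)| ^ 3) := by linear_combination -h1
    have hm1 : m 1 * (planarDet (q 0) (q 1) / |planarDet (q 0) (q 1)| ^ 3) =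
        m 2 * (planarDet (q 2) (q 0) / |planarDet (q 2) (q 0)| ^ 3) := by linear_combination h0
    refine ⟨?_, hm0, hm1⟩
    rintro ⟨u, hu, hpos⟩
    exact not_exists_closed_semicircle (mul_pos_of_mul_div_abs_cube (hm 0) (hm 2) ha hc hm0)
      (mul_pos_of_mul_div_abs_cube (hm 1) (hm 2) hb hc hm1) hu (hpos 0) (hpos 1) (hpos 2)
  · rintro ⟨-, hm0, hm1⟩
    refine ⟨by linear_combination hm1, by linear_combination -hm0, ?_⟩
    refine (mul_eq_zero.mp ?_).resolve_left (hm 2).ne'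
    linear_combination m 1 * hm0 - m 0 * hm1
end

section
/- Consider four positive masses m_1, m_2, m_3, m_4 and a nonsingular configuration q = (q_1, q_2, q_3, q_4) on S^2 ⊂ ℝ³ spanning ℝ³, with Δ_k = (−1)^{k+1} det(X_k) for X = [q_1, q_2, q_3, q_4]. Then q is a special central configuration if and only if: q_1, q_2, q_3, q_4 do not all lie in a common closed hemisphere (i.e. there is no unit vector u ∈ ℝ³ with u·q_i ≥ 0 for all i); the shape equations sin d_12 · sin d_34 = sin d_13 · sin d_24 = sin d_14 · sin d_23 hold; and the mass vector satisfies (m_1, m_2, m_3, m_4) = ( (sin³d_12 · Δ_1)/(sin³d_24 · Δ_4), (sin³d_12 · Δ_2)/(sin³d_14 · Δ_4), (sin³d_13 · Δ_3)/(sin³d_14 · Δ_4), 1 ) · m_4. -/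
open Real Matrix Finset

/-- The only vector orthogonal to a spanning family is zero. -/
lemma eq_zero_of_dotProduct_span {ι κ : Type*} [Fintype κ] {q : ι → κ → ℝ}
    (hspan : Submodule.span ℝ (Set.range q) = ⊤) {u : κ → ℝ} (hu : ∀ i, u ⬝ᵥ q i = 0) :
    u = 0 := by
  have hmem : u ∈ Submodule.span ℝ (Set.range q) := hspan ▸ Submodule.mem_top
  have key : ∀ x ∈ Submodule.span ℝ (Set.range q), u ⬝ᵥ x = 0 := by
    intro x hx
    induction hx using Submodule.span_induction with
    | mem x hx => obtain ⟨i, rfl⟩ := hx; exact hu i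
    | zero => simp
    | add x y _ _ hx hy => rw [dotProduct_add, hx, hy, add_zero]
    | smul a x _ hx => rw [dotProduct_smul, hx, smul_zero]
  exact dotProduct_self_eq_zero.mp (key u hmem)

lemma one_sub_dotProduct_sq_pos {κ : Type*} [Fintype κ] {x y : κ → ℝ} (hx : x ⬝ᵥ x = 1)
    (hy : y ⬝ᵥ y = 1) (hne : x ≠ y) (hne' : x ≠ -y) : 0 < 1 - (x ⬝ᵥ y) ^ 2 := by
  have pos : ∀ z : κ → ℝ, z ≠ 0 → 0 < z ⬝ᵥ z := fun z hz =>
    lt_of_le_of_ne (Finset.sum_nonneg fun i _ => mul_self_nonneg (z i))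
      fun h => hz (dotProduct_self_eq_zero.mp h.symm)
  have h1 := pos (x - y) (sub_ne_zero.mpr hne)
  have h2 := pos (x + y) fun h => hne' (eq_neg_of_add_eq_zero_left h)
  simp only [sub_dotProduct, dotProduct_sub, add_dotProduct, dotProduct_add,
    dotProduct_comm y x, hx, hy] at h1 h2
  nlinarith

lemma dotProduct_cross_eq (x y z : Fin 3 → ℝ) :
    x ⬝ᵥ (y ⨯₃ z) = x 0 * (y 1 * z 2 - y 2 * z 1) + x 1 * (y 2 * z 0 - y 0 * z 2) +
      x 2 * (y 0 * z 1 - y 1 * z 0) := by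
  rw [cross_apply, dotProduct, Fin.sum_univ_three]
  rfl

/-- The signed maximal minors of four vectors in `ℝ³`. -/
lemma signed_minor_eq {q : Fin 4 → Fin 3 → ℝ} {X : Matrix (Fin 3) (Fin 4) ℝ}
    (hX : ∀ r c, X r c = q c r) {Δ : Fin 4 → ℝ}
    (hΔ : ∀ k, Δ k = (-1) ^ (k : ℕ) * (X.submatrix id (Fin.succAbove k)).det) :
    Δ 0 = q 1 ⬝ᵥ (q 2 ⨯₃ q 3) ∧ Δ 1 = -(q 0 ⬝ᵥ (q 2 ⨯₃ q 3)) ∧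
      Δ 2 = q 0 ⬝ᵥ (q 1 ⨯₃ q 3) ∧ Δ 3 = -(q 0 ⬝ᵥ (q 1 ⨯₃ q 2)) := by
  refine ⟨?_, ?_, ?_, ?_⟩ <;>
  · rw [hΔ, dotProduct_cross_eq]
    simp [det_fin_three, hX, Fin.succAbove, Fin.lt_def]
    ring

/-- The signed maximal minors are the coefficients of a linear relation. -/
lemma sum_signed_minor_smul {q : Fin 4 → Fin 3 → ℝ} {X : Matrix (Fin 3) (Fin 4) ℝ}
    (hX : ∀ r c, X r c = q c r) {Δ : Fin 4 → ℝ}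
    (hΔ : ∀ k, Δ k = (-1) ^ (k : ℕ) * (X.submatrix id (Fin.succAbove k)).det) :
    ∑ k, Δ k • q k = 0 := by
  obtain ⟨h0, h1, h2, h3⟩ := signed_minor_eq hX hΔ
  ext r
  simp only [Fin.sum_univ_four, h0, h1, h2, h3, dotProduct_cross_eq]
  fin_cases r <;> simp <;> ring

/-- Any linear relation is proportional to the one given by the signed maximal minors. -/
lemma mul_signed_minor_comm {q : Fin 4 → Fin 3 → ℝ} {X : Matrix (Fin 3) (Fin 4) ℝ}
    (hX : ∀ r c, X r c = q c r) {Δ : Fin 4 → ℝ}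
    (hΔ : ∀ k, Δ k = (-1) ^ (k : ℕ) * (X.submatrix id (Fin.succAbove k)).det)
    {a : Fin 4 → ℝ} (ha : ∑ k, a k • q k = 0) (j k : Fin 4) : a j * Δ k = a k * Δ j := by
  obtain ⟨h0, h1, h2, h3⟩ := signed_minor_eq hX hΔ
  have hpair : ∀ v w, ∑ k, a k * (q k ⬝ᵥ (v ⨯₃ w)) = 0 := by
    intro v w
    simpa [sum_dotProduct] using congrArg (· ⬝ᵥ (v ⨯₃ w)) ha
  have e01 := hpair (q 0) (q 1)
  have e02 := hpair (q 0) (q 2)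
  have e03 := hpair (q 0) (q 3)
  have e12 := hpair (q 1) (q 2)
  have e13 := hpair (q 1) (q 3)
  have e23 := hpair (q 2) (q 3)
  simp only [Fin.sum_univ_four, dotProduct_cross_eq] at h0 h1 h2 h3 e01 e02 e03 e12 e13 e23
  fin_cases j <;> fin_cases k <;>
    simp only [Fin.zero_eta, Fin.mk_one, Fin.reduceFinMk, h0, h1, h2, h3] <;>
    linarith only [e01, e02, e03, e12, e13, e23]

/-- The signed maximal minors of a spanning family, two members of which are not parallel,
do not all vanish. -/
lemma exists_signed_minor_ne_zero {q : Fin 4 → Fin 3 → ℝ} {X : Matrix (Fin 3) (Fin 4) ℝ}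
    (hX : ∀ r c, X r c = q c r) {Δ : Fin 4 → ℝ}
    (hΔ : ∀ k, Δ k = (-1) ^ (k : ℕ) * (X.submatrix id (Fin.succAbove k)).det)
    (hspan : Submodule.span ℝ (Set.range q) = ⊤) (hunit : ∀ i, q i ⬝ᵥ q i = 1)
    (h01 : 0 < 1 - (q 0 ⬝ᵥ q 1) ^ 2) : ∃ k, Δ k ≠ 0 := by
  by_contra! h
  obtain ⟨-, -, h2, h3⟩ := signed_minor_eq hX hΔ
  rw [h] at h2 h3
  have hu : (q 0 ⨯₃ q 1) = 0 := by
    refine eq_zero_of_dotProduct_span hspan fun i => ?_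
    rw [dotProduct_comm]
    fin_cases i
    · exact dot_self_cross _ _
    · exact dot_cross_self _ _
    · simp only [Fin.reduceFinMk]
      rw [triple_product_permutation, neg_eq_zero.mp h3.symm]
    · simp only [Fin.reduceFinMk]
      rw [triple_product_permutation, ← h2]
  have := cross_dot_cross (q 0) (q 1) (q 0) (q 1)
  rw [hu, hunit, hunit, dotProduct_comm (q 1) (q 0)] at this
  simp only [zero_dotProduct] at this
  nlinarith

/-- A family of vectors balanced by coefficients whose pairwise products are positive lies in no
closed hemisphere. -/
lemma no_hemisphere {ι κ : Type*} [Fintype ι] [Nonempty ι] [Fintype κ] {q : ι → κ → ℝ}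
    {Δ : ι → ℝ} (hspan : Submodule.span ℝ (Set.range q) = ⊤) (hrel : ∑ k, Δ k • q k = 0)
    (hpos : ∀ j k, 0 < Δ j * Δ k) :
    ¬ ∃ u : κ → ℝ, u ⬝ᵥ u = 1 ∧ ∀ i, 0 ≤ u ⬝ᵥ q i := by
  rintro ⟨u, hu, hq⟩
  obtain ⟨i₀⟩ := ‹Nonempty ι›
  have hsum : ∑ k, Δ i₀ * Δ k * (u ⬝ᵥ q k) = 0 := by
    have := congrArg (fun x => Δ i₀ * (u ⬝ᵥ x)) hrel
    simpa [dotProduct_sum, Finset.mul_sum, mul_assoc] using this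
  rw [Finset.sum_eq_zero_iff_of_nonneg fun k _ => mul_nonneg (hpos i₀ k).le (hq k)] at hsum
  have : u = 0 := eq_zero_of_dotProduct_span hspan fun i =>
    (mul_eq_zero.mp (hsum i (Finset.mem_univ i))).resolve_left (hpos i₀ i).ne'
  simp [this] at hu

/-- Tangential forces with coefficients proportional to those of a linear relation cancel. -/
lemma sum_tangential_eq_zero {ι κ : Type*} [Fintype ι] [DecidableEq ι] [Fintype κ]
    {q : ι → κ → ℝ} {Δ w : ι → ℝ} (hrel : ∑ k, Δ k • q k = 0) {i : ι}
    (hi : q i ⬝ᵥ q i = 1) {c : ℝ} (hw : ∀ j, j ≠ i → w j = c * Δ j) :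
    ∑ j ∈ Finset.univ.erase i, w j • (q j - (q i ⬝ᵥ q j) • q i) = 0 := by
  have h1 : ∑ j, (c * Δ j) • (q j - (q i ⬝ᵥ q j) • q i) = 0 := by
    have h2 := congrArg (q i ⬝ᵥ ·) hrel
    simp only [dotProduct_sum, dotProduct_smul, dotProduct_zero, smul_eq_mul] at h2
    simp only [smul_sub, Finset.sum_sub_distrib, smul_smul, mul_assoc]
    rw [← Finset.sum_smul, ← Finset.mul_sum, h2]
    simp only [mul_smul, ← Finset.smul_sum, hrel]
    simp
  rw [← h1, ← Finset.add_sum_erase _ _ (Finset.mem_univ i)]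
  rw [hi, one_smul, sub_self, smul_zero, zero_add]
  exact Finset.sum_congr rfl fun j hj => by rw [hw j (Finset.ne_of_mem_erase hj)]

/-- Vanishing of the tangential force at `i` makes the coefficients proportional to the signed
maximal minors. -/
lemma coeff_mul_signed_minor_comm {q : Fin 4 → Fin 3 → ℝ} {X : Matrix (Fin 3) (Fin 4) ℝ}
    (hX : ∀ r c, X r c = q c r) {Δ : Fin 4 → ℝ}
    (hΔ : ∀ k, Δ k = (-1) ^ (k : ℕ) * (X.submatrix id (Fin.succAbove k)).det)
    {w : Fin 4 → ℝ} {i : Fin 4}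
    (h : ∑ j ∈ Finset.univ.erase i, w j • (q j - (q i ⬝ᵥ q j) • q i) = 0)
    {j k : Fin 4} (hj : j ≠ i) (hk : k ≠ i) : w j * Δ k = w k * Δ j := by
  let a : Fin 4 → ℝ := Function.update w i (-∑ j ∈ Finset.univ.erase i, w j * (q i ⬝ᵥ q j))
  have ha : ∑ k, a k • q k = 0 := by
    rw [← Finset.add_sum_erase _ _ (Finset.mem_univ i), ← h]
    have : ∑ k ∈ Finset.univ.erase i, a k • q k = ∑ k ∈ Finset.univ.erase i, w k • q k :=
      Finset.sum_congr rfl fun k hk => by simp [a, Finset.ne_of_mem_erase hk]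
    rw [this]
    simp only [a, Function.update_self, smul_sub, Finset.sum_sub_distrib, smul_smul, neg_smul,
      ← Finset.sum_smul]
    abel
  simpa [a, hj, hk] using mul_signed_minor_comm hX hΔ ha j k

/-- Positive coefficients proportional, off each index, to a nonzero vector force all entries of
that vector to have the same sign. -/
lemma mul_pos_of_coeff_comm {Δ : Fin 4 → ℝ} {w : Fin 4 → Fin 4 → ℝ}
    (hw : ∀ i j, i ≠ j → 0 < w i j)
    (hR : ∀ i j k, j ≠ i → k ≠ i → w i j * Δ k = w i k * Δ j) (hne : ∃ k, Δ k ≠ 0)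
    (j k : Fin 4) : 0 < Δ j * Δ k := by
  have third : ∀ j k : Fin 4, ∃ i, j ≠ i ∧ k ≠ i := by decide
  obtain ⟨l, hl⟩ := hne
  have hall : ∀ k, Δ k ≠ 0 := by
    intro k hk
    obtain ⟨i, hki, hli⟩ := third k l
    have := hR i k l hki hli
    rw [hk, mul_zero] at this
    exact mul_ne_zero (hw i k hki.symm).ne' hl this
  obtain ⟨i, hji, hki⟩ := third j k
  have h1 := hR i j k hji hki
  have h2 : 0 < w i k * (Δ j * Δ k) := by
    rw [← mul_assoc, ← h1, mul_assoc]
    exact mul_pos (hw i j hji.symm) (mul_self_pos.mpr (hall k))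
  exact pos_of_mul_pos_right h2 (hw i k hki.symm).le

/-- Criterion for 4-body Dziobek special central configurations on S²: q is an
SCC iff the bodies do not lie in a common closed hemisphere, the shape
equations sin d₁₂ sin d₃₄ = sin d₁₃ sin d₂₄ = sin d₁₄ sin d₂₃ hold, and the
masses are proportional to the stated ratios. Bodies are indexed 0,…,3. -/
theorem stmt15 (m : Fin 4 → ℝ) (q : Fin 4 → Fin 3 → ℝ)
    (hm : ∀ i, 0 < m i)
    (hunit : ∀ i, q i ⬝ᵥ q i = 1)
    (hns : ∀ i j, i ≠ j → q i ≠ q j ∧ q i ≠ -q j)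
    (hspan : Submodule.span ℝ (Set.range q) = ⊤)
    (X : Matrix (Fin 3) (Fin 4) ℝ) (hX : ∀ r c, X r c = q c r)
    (Δ : Fin 4 → ℝ)
    (hΔ : ∀ k, Δ k = (-1) ^ (k : ℕ) * (X.submatrix id (Fin.succAbove k)).det) :
    (∀ i, (∑ j ∈ Finset.univ.erase i,
        ((m i * m j) / (Real.sqrt (1 - (q i ⬝ᵥ q j) ^ 2)) ^ 3) •
          (q j - (q i ⬝ᵥ q j) • q i)) = 0) ↔
      ((¬ ∃ u : Fin 3 → ℝ, u ⬝ᵥ u = 1 ∧ ∀ i, 0 ≤ u ⬝ᵥ q i) ∧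
        Real.sqrt (1 - (q 0 ⬝ᵥ q 1) ^ 2) * Real.sqrt (1 - (q 2 ⬝ᵥ q 3) ^ 2) =
          Real.sqrt (1 - (q 0 ⬝ᵥ q 2) ^ 2) * Real.sqrt (1 - (q 1 ⬝ᵥ q 3) ^ 2) ∧
        Real.sqrt (1 - (q 0 ⬝ᵥ q 2) ^ 2) * Real.sqrt (1 - (q 1 ⬝ᵥ q 3) ^ 2) =
          Real.sqrt (1 - (q 0 ⬝ᵥ q 3) ^ 2) * Real.sqrt (1 - (q 1 ⬝ᵥ q 2) ^ 2) ∧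
        m 0 = (Real.sqrt (1 - (q 0 ⬝ᵥ q 1) ^ 2)) ^ 3 * Δ 0 /
                ((Real.sqrt (1 - (q 1 ⬝ᵥ q 3) ^ 2)) ^ 3 * Δ 3) * m 3 ∧
        m 1 = (Real.sqrt (1 - (q 0 ⬝ᵥ q 1) ^ 2)) ^ 3 * Δ 1 /
                ((Real.sqrt (1 - (q 0 ⬝ᵥ q 3) ^ 2)) ^ 3 * Δ 3) * m 3 ∧
        m 2 = (Real.sqrt (1 - (q 0 ⬝ᵥ q 2) ^ 2)) ^ 3 * Δ 2 /
                ((Real.sqrt (1 - (q 0 ⬝ᵥ q 3) ^ 2)) ^ 3 * Δ 3) * m 3) := by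
  set s : Fin 4 → Fin 4 → ℝ := fun i j => √(1 - (q i ⬝ᵥ q j) ^ 2) with hs
  have hs_pos : ∀ i j, i ≠ j → 0 < s i j := fun i j hij => Real.sqrt_pos.mpr
    (one_sub_dotProduct_sq_pos (hunit i) (hunit j) (hns i j hij).1 (hns i j hij).2)
  have hs_symm : ∀ i j, s i j = s j i := fun i j => by simp only [hs, dotProduct_comm]
  have hrel := sum_signed_minor_smul hX hΔ
  change (∀ i, ∑ j ∈ Finset.univ.erase i,
      (m i * m j / s i j ^ 3) • (q j - (q i ⬝ᵥ q j) • q i) = 0) ↔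
    (_ ∧ s 0 1 * s 2 3 = s 0 2 * s 1 3 ∧ s 0 2 * s 1 3 = s 0 3 * s 1 2 ∧
      m 0 = s 0 1 ^ 3 * Δ 0 / (s 1 3 ^ 3 * Δ 3) * m 3 ∧
      m 1 = s 0 1 ^ 3 * Δ 1 / (s 0 3 ^ 3 * Δ 3) * m 3 ∧
      m 2 = s 0 2 ^ 3 * Δ 2 / (s 0 3 ^ 3 * Δ 3) * m 3)
  constructor
  · intro h
    have hR := fun i j k (hj : j ≠ i) (hk : k ≠ i) => coeff_mul_signed_minor_comm hX hΔ (h i) hj hk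
    have hpos : ∀ j k, 0 < Δ j * Δ k := mul_pos_of_coeff_comm
      (w := fun i j => m i * m j / s i j ^ 3)
      (fun i j hij => div_pos (mul_pos (hm i) (hm j)) (pow_pos (hs_pos i j hij) 3)) hR
      (exists_signed_minor_ne_zero hX hΔ hspan hunit (Real.sqrt_pos.mp (hs_pos 0 1 (by decide))))
    have hne : ∀ k, Δ k ≠ 0 := fun k => left_ne_zero_of_mul (hpos k k).ne'
    have hT : ∀ i j k, j ≠ i → k ≠ i → m j * Δ k * s i k ^ 3 = m k * Δ j * s i j ^ 3 := by
      intro i j k hj hk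
      have h1 := hR i j k hj hk
      have h2 := (hs_pos i j hj.symm).ne'
      have h3 := (hs_pos i k hk.symm).ne'
      have h4 := (hm i).ne'
      field_simp at h1
      linear_combination h1
    have hshape : ∀ i j k l, j ≠ i → k ≠ i → j ≠ l → k ≠ l → i ≠ l →
        s i j * s k l = s i k * s j l := by
      intro i j k l hji hki hjl hkl hil
      have h1 := hT i j k hji hki
      have h2 := hT l j k hjl hkl
      rw [hs_symm l, hs_symm l] at h2
      have h3 : m j * Δ k ≠ 0 := mul_ne_zero (hm j).ne' (hne k)
      have h4 : (s i j * s k l) ^ 3 = (s i k * s j l) ^ 3 := by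
        have h5 : m k * Δ j ≠ 0 := mul_ne_zero (hm k).ne' (hne j)
        refine mul_left_cancel₀ (mul_ne_zero h3 h5) ?_
        linear_combination m k * Δ j * s i j ^ 3 * h2 - m k * Δ j * s j l ^ 3 * h1
      exact (pow_left_inj₀ (mul_pos (hs_pos _ _ hji.symm) (hs_pos _ _ hkl)).le
        (mul_pos (hs_pos _ _ hki.symm) (hs_pos _ _ hjl)).le three_ne_zero).mp h4
    have hmass : ∀ i j, j ≠ i → 3 ≠ i →
        m j = s i j ^ 3 * Δ j / (s i 3 ^ 3 * Δ 3) * m 3 := by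
      intro i j hj h3
      have h1 := hT i j 3 hj h3
      have h2 := (hs_pos i 3 h3.symm).ne'
      have h4 := hne 3
      field_simp
      linear_combination h1
    refine ⟨no_hemisphere hspan hrel hpos, hshape 0 1 2 3 ?_ ?_ ?_ ?_ ?_, ?_, ?_, ?_, ?_⟩
    any_goals decide
    · rw [hs_symm 1 3, hs_symm 1 2]
      exact hshape 0 2 3 1 (by decide) (by decide) (by decide) (by decide) (by decide)
    · rw [hs_symm 0 1]; exact hmass 1 0 (by decide) (by decide)
    · exact hmass 0 1 (by decide) (by decide)
    · exact hmass 0 2 (by decide) (by decide)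
  · rintro ⟨-, hA, hB, h0, h1, h2⟩ i
    have hΔ3 : Δ 3 ≠ 0 := by
      intro h
      have := (hm 0).ne'
      rw [h0, h] at this
      simp at this
    have hcoef : ∃ c, ∀ j, j ≠ i → m j = c * Δ j * s i j ^ 3 := by
      have p01 := (hs_pos 0 1 (by decide)).ne'
      have p03 := (hs_pos 0 3 (by decide)).ne'
      have p13 := (hs_pos 1 3 (by decide)).ne'
      have p23 := (hs_pos 2 3 (by decide)).ne'
      have hA' : s 0 1 ^ 3 * s 2 3 ^ 3 = s 0 2 ^ 3 * s 1 3 ^ 3 := by rw [← mul_pow, hA, mul_pow]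
      have hB' : s 0 2 ^ 3 * s 1 3 ^ 3 = s 0 3 ^ 3 * s 1 2 ^ 3 := by rw [← mul_pow, hB, mul_pow]
      fin_cases i
      · refine ⟨m 3 / (Δ 3 * s 0 3 ^ 3), fun j hj => ?_⟩
        fin_cases j <;> simp at hj ⊢
        · rw [h1]; field_simp
        · rw [h2]; field_simp
        · field_simp
      · refine ⟨m 3 / (Δ 3 * s 1 3 ^ 3), fun j hj => ?_⟩
        fin_cases j <;> simp at hj ⊢
        · rw [h0, hs_symm 1 0]; field_simp
        · rw [h2]; field_simp; linear_combination Δ 2 * m 3 * hB'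
        · field_simp
      · refine ⟨m 3 / (Δ 3 * s 2 3 ^ 3), fun j hj => ?_⟩
        fin_cases j <;> simp at hj ⊢
        · rw [h0, hs_symm 2 0]; field_simp; linear_combination Δ 0 * m 3 * hA'
        · rw [h1, hs_symm 2 1]; field_simp; linear_combination Δ 1 * m 3 * (hA' + hB')
        · field_simp
      · refine ⟨m 3 * s 0 1 ^ 3 / (Δ 3 * s 0 3 ^ 3 * s 1 3 ^ 3), fun j hj => ?_⟩
        fin_cases j <;> simp at hj ⊢
        · rw [h0, hs_symm 3 0]; field_simp
        · rw [h1, hs_symm 3 1]; field_simp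
        · rw [h2, hs_symm 3 2]; field_simp; linear_combination -Δ 2 * m 3 * hA'
    obtain ⟨c, hc⟩ := hcoef
    refine sum_tangential_eq_zero hrel (hunit i) (c := m i * c) fun j hj => ?_
    have := (hs_pos i j hj.symm).ne'
    rw [div_eq_iff (pow_ne_zero 3 this), hc j hj]
    ring
end

section
/- Fix c ∈ (0,1) and let r = √(1−c²). Define the configuration q_c on S^2 ⊂ ℝ³ by q_1 = (1, 0, 0), q_2 = (−c, r, 0), q_3 = (−c, −r/2, (√3/2)r), q_4 = (−c, −r/2, −(√3/2)r). If the positive masses satisfy m_2 = m_3 = m_4 and m_1/m_4 = 8√3·c / (3(1+3c²)^{3/2}), then q_c is a special central configuration. -/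
open Real Matrix Finset

/-- The tetrahedral family q_c on S²: one body at (1,0,0) and three bodies on
an equilateral triangle at height −c, with masses m₂ = m₃ = m₄ and
m₁/m₄ = 8√3 c / (3(1+3c²)^{3/2}), is a special central configuration. -/
theorem stmt16 (c : ℝ) (hc : c ∈ Set.Ioo (0 : ℝ) 1) (r : ℝ) (hr : r = Real.sqrt (1 - c ^ 2))
    (m : Fin 4 → ℝ) (hm : ∀ i, 0 < m i)
    (hm23 : m 1 = m 3) (hm33 : m 2 = m 3)
    (hm14 : m 0 / m 3 = 8 * Real.sqrt 3 * c / (3 * Real.sqrt ((1 + 3 * c ^ 2) ^ 3)))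
    (q : Fin 4 → Fin 3 → ℝ)
    (hq0 : q 0 = ![1, 0, 0])
    (hq1 : q 1 = ![-c, r, 0])
    (hq2 : q 2 = ![-c, -(r / 2), Real.sqrt 3 / 2 * r])
    (hq3 : q 3 = ![-c, -(r / 2), -(Real.sqrt 3 / 2 * r)]) :
    ∀ i, (∑ j ∈ Finset.univ.erase i,
        ((m i * m j) / (Real.sqrt (1 - (q i ⬝ᵥ q j) ^ 2)) ^ 3) •
          (q j - (q i ⬝ᵥ q j) • q i)) = 0 := by
  obtain ⟨hc0, hc1⟩ := hc
  have hrpos : 0 < r := hr ▸ Real.sqrt_pos.2 (by nlinarith)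
  have hr2 : r ^ 2 = 1 - c ^ 2 := by rw [hr, Real.sq_sqrt]; nlinarith
  have h3 : Real.sqrt 3 ^ 2 = 3 := Real.sq_sqrt (by norm_num)
  have h3pos : 0 < Real.sqrt 3 := by positivity
  -- The tip is at inner product `-c` from the triangle, whose vertices are at `(3c² - 1)/2`.
  have d01 : q 0 ⬝ᵥ q 1 = -c := by simp [hq0, hq1]
  have d02 : q 0 ⬝ᵥ q 2 = -c := by simp [hq0, hq2]
  have d03 : q 0 ⬝ᵥ q 3 = -c := by simp [hq0, hq3]
  have d12 : q 1 ⬝ᵥ q 2 = (3 * c ^ 2 - 1) / 2 := by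
    simp [hq1, hq2]; linear_combination (-1 / 2) * hr2
  have d13 : q 1 ⬝ᵥ q 3 = (3 * c ^ 2 - 1) / 2 := by
    simp [hq1, hq3]; linear_combination (-1 / 2) * hr2
  have d23 : q 2 ⬝ᵥ q 3 = (3 * c ^ 2 - 1) / 2 := by
    simp [hq2, hq3]
    linear_combination (-1 / 2) * hr2 - r ^ 2 / 4 * h3
  have s0 : Real.sqrt (1 - (-c) ^ 2) = r := by rw [hr, neg_sq]
  have s1 : Real.sqrt (1 - ((3 * c ^ 2 - 1) / 2) ^ 2) =
      Real.sqrt 3 / 2 * r * Real.sqrt (1 + 3 * c ^ 2) := by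
    rw [Real.sqrt_eq_iff_mul_self_eq_of_pos (by positivity)]
    have hs : Real.sqrt (1 + 3 * c ^ 2) ^ 2 = 1 + 3 * c ^ 2 := Real.sq_sqrt (by positivity)
    calc _ = Real.sqrt 3 ^ 2 / 4 * r ^ 2 * Real.sqrt (1 + 3 * c ^ 2) ^ 2 := by ring
      _ = _ := by rw [h3, hr2, hs]; ring
  have hs3 : Real.sqrt ((1 + 3 * c ^ 2) ^ 3) = Real.sqrt (1 + 3 * c ^ 2) ^ 3 := by
    rw [Real.sqrt_eq_iff_mul_self_eq_of_pos (by positivity), ← mul_pow,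
      Real.mul_self_sqrt (by positivity)]
  have hm3 := hm 3
  have hspos : 0 < Real.sqrt (1 + 3 * c ^ 2) := by positivity
  -- The balance between the pull of the tip and that of the other triangle vertices.
  have balance : m 0 / r ^ 3 =
      3 * c * (m 3 / (Real.sqrt 3 / 2 * r * Real.sqrt (1 + 3 * c ^ 2)) ^ 3) := by
    rw [hs3, div_eq_iff hm3.ne'] at hm14
    rw [hm14]
    field_simp
    linear_combination 8 * (Real.sqrt 3 ^ 2 + 3) * h3
  have e0 : (univ : Finset (Fin 4)).erase 0 = {1, 2, 3} := by decide
  have e1 : (univ : Finset (Fin 4)).erase 1 = {0, 2, 3} := by decide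
  have e2 : (univ : Finset (Fin 4)).erase 2 = {0, 1, 3} := by decide
  have e3 : (univ : Finset (Fin 4)).erase 3 = {0, 1, 2} := by decide
  have d10 := (dotProduct_comm _ _).trans d01
  have d20 := (dotProduct_comm _ _).trans d02
  have d30 := (dotProduct_comm _ _).trans d03
  have d21 := (dotProduct_comm _ _).trans d12
  have d31 := (dotProduct_comm _ _).trans d13
  have d32 := (dotProduct_comm _ _).trans d23
  intro i
  fin_cases i <;>
    simp only [Fin.zero_eta, Fin.mk_one, Fin.reduceFinMk, e0, e1, e2, e3, Finset.sum_insert,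
      Finset.mem_insert, Finset.mem_singleton, Finset.sum_singleton, Fin.reduceEq, zero_ne_one,
      or_self, not_false_eq_true, d01, d02, d03, d10, d12,
      d13, d20, d21, d23, d30, d31, d32, s0, s1, mul_div_assoc, hm23, hm33, balance] <;>
    generalize m 3 / (Real.sqrt 3 / 2 * r * Real.sqrt (1 + 3 * c ^ 2)) ^ 3 = B <;>
    generalize m 3 / r ^ 3 = A <;>
    ext k <;> fin_cases k <;>
    simp [hq0, hq1, hq2, hq3]
  all_goals ring
end

section
/- Fix c ∈ (0,1), let r = √(1−c²) and s = √(1 − c² − r²/9). Define the configuration q_c on S^3 ⊂ ℝ⁴ by q_1 = (1,0,0,0), q_2 = (−c, r, 0, 0), q_3 = (−c, −r/3, s, 0), q_4 = (−c, −r/3, −s/2, (√3/2)s), q_5 = (−c, −r/3, −s/2, −(√3/2)s). If the positive masses satisfy m_2 = m_3 = m_4 = m_5 and m_1/m_5 = 27c / (4√2 (1+2c²)^{3/2}), then q_c is a special central configuration. -/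
open Real Matrix Finset

/-- If `d = (4 c² - 1) / 3` is the cosine of a distance, the cube of its sine, in factored form. -/
lemma sqrt_one_sub_sq_pow_three (c : ℝ) :
    √(1 - ((4 * c ^ 2 - 1) / 3) ^ 2) ^ 3 =
      √(1 - c ^ 2) ^ 3 * (16 * √2 / 27 * √((1 + 2 * c ^ 2) ^ 3)) := by
  have hpos : (0 : ℝ) ≤ 1 + 2 * c ^ 2 := by positivity
  have hfactor : 1 - ((4 * c ^ 2 - 1) / 3) ^ 2 =
      (2 / 3) ^ 2 * (2 * ((1 + 2 * c ^ 2) * (1 - c ^ 2))) := by ring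
  have hcube : √((1 + 2 * c ^ 2) ^ 3) = √(1 + 2 * c ^ 2) ^ 3 := by
    rw [Real.sqrt_eq_iff_mul_self_eq (by positivity) (by positivity), ← mul_pow,
      Real.mul_self_sqrt hpos]
  have htwo : √2 ^ 2 = (2 : ℝ) := Real.sq_sqrt (by norm_num)
  rw [hfactor, hcube, Real.sqrt_mul (by positivity), Real.sqrt_sq (by norm_num),
    Real.sqrt_mul (by norm_num), Real.sqrt_mul hpos]
  linear_combination (8 / 27 * √2 * √(1 + 2 * c ^ 2) ^ 3 * √(1 - c ^ 2) ^ 3) * htwo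

/-- The pentatope family q_c in S³: one body at (1,0,0,0) and four bodies on a
regular tetrahedron at height −c, with masses m₂ = m₃ = m₄ = m₅ and
m₁/m₅ = 27c / (4√2 (1+2c²)^{3/2}), is a special central configuration. -/
theorem stmt19 (c : ℝ) (hc : c ∈ Set.Ioo (0 : ℝ) 1)
    (r : ℝ) (hr : r = Real.sqrt (1 - c ^ 2))
    (s : ℝ) (hs : s = Real.sqrt (1 - c ^ 2 - r ^ 2 / 9))
    (m : Fin 5 → ℝ) (hm : ∀ i, 0 < m i)
    (hm2 : m 1 = m 4) (hm3 : m 2 = m 4) (hm4 : m 3 = m 4)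
    (hm15 : m 0 / m 4 = 27 * c / (4 * Real.sqrt 2 * Real.sqrt ((1 + 2 * c ^ 2) ^ 3)))
    (q : Fin 5 → Fin 4 → ℝ)
    (hq0 : q 0 = ![1, 0, 0, 0])
    (hq1 : q 1 = ![-c, r, 0, 0])
    (hq2 : q 2 = ![-c, -(r / 3), s, 0])
    (hq3 : q 3 = ![-c, -(r / 3), -(s / 2), Real.sqrt 3 / 2 * s])
    (hq4 : q 4 = ![-c, -(r / 3), -(s / 2), -(Real.sqrt 3 / 2 * s)]) :
    ∀ i, (∑ j ∈ Finset.univ.erase i,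
        ((m i * m j) / (Real.sqrt (1 - (q i ⬝ᵥ q j) ^ 2)) ^ 3) •
          (q j - (q i ⬝ᵥ q j) • q i)) = 0 := by
  obtain ⟨hc0, hc1⟩ := hc
  have hcc : 0 < 1 - c ^ 2 := by nlinarith
  have hr0 : 0 < r := hr ▸ Real.sqrt_pos.2 hcc
  have hr2 : r ^ 2 = 1 - c ^ 2 := hr ▸ Real.sq_sqrt hcc.le
  have hs2 : s ^ 2 = 8 / 9 * (1 - c ^ 2) := by
    rw [hs, Real.sq_sqrt] <;> rw [hr2] <;> linarith
  have h3 : √3 ^ 2 = (3 : ℝ) := Real.sq_sqrt (by norm_num)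
  obtain ⟨d, hd⟩ : ∃ d, d = (4 * c ^ 2 - 1) / 3 := ⟨_, rfl⟩
  have hdot : q 1 ⬝ᵥ q 2 = d ∧ q 1 ⬝ᵥ q 3 = d ∧ q 1 ⬝ᵥ q 4 = d ∧
      q 2 ⬝ᵥ q 3 = d ∧ q 2 ⬝ᵥ q 4 = d ∧ q 3 ⬝ᵥ q 4 = d := by
    simp only [hq1, hq2, hq3, hq4, hd, dotProduct, Fin.sum_univ_four, Matrix.cons_val]
    refine ⟨?_, ?_, ?_, ?_, ?_, ?_⟩
    · linear_combination (-1 / 3) * hr2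
    · linear_combination (-1 / 3) * hr2
    · linear_combination (-1 / 3) * hr2
    · linear_combination (1 / 9) * hr2 - (1 / 2) * hs2
    · linear_combination (1 / 9) * hr2 - (1 / 2) * hs2
    · linear_combination (1 / 9) * hr2 - (1 / 2) * hs2 - (s ^ 2 / 4) * h3
  obtain ⟨h12, h13, h14, h23, h24, h34⟩ := hdot
  have hapex : q 0 ⬝ᵥ q 1 = -c ∧ q 0 ⬝ᵥ q 2 = -c ∧ q 0 ⬝ᵥ q 3 = -c ∧ q 0 ⬝ᵥ q 4 = -c := by
    simp [hq0, hq1, hq2, hq3, hq4, dotProduct, Fin.sum_univ_four]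
  obtain ⟨h01, h02, h03, h04⟩ := hapex
  have hsum : ∀ k, q 1 k + q 2 k + q 3 k + q 4 k = -4 * c * q 0 k := by
    intro k
    fin_cases k <;> simp [hq0, hq1, hq2, hq3, hq4] <;> ring
  have hM := hm 4
  have hbalance : m 4 * m 0 / r ^ 3 = 4 * c * (m 4 * m 4 / √(1 - d ^ 2) ^ 3) := by
    rw [div_eq_iff hM.ne'] at hm15
    rw [hd, sqrt_one_sub_sq_pow_three, ← hr, hm15]
    field_simp
    norm_num
  have hdc : 3 * d = 4 * c ^ 2 - 1 := by rw [hd]; ring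
  have hsin : √(1 - (-c) ^ 2) = r := by rw [hr, neg_sq]
  have hswap := fun i j => dotProduct_comm (q i) (q j)
  have hbase : ∀ i, ∑ j ∈ univ.erase i, ((m i * m j) / √(1 - (q i ⬝ᵥ q j) ^ 2) ^ 3) •
      (q j - (q i ⬝ᵥ q j) • q i) = ∑ j, if j = i then 0 else
        ((m i * m j) / √(1 - (q i ⬝ᵥ q j) ^ 2) ^ 3) • (q j - (q i ⬝ᵥ q j) • q i) := by
    intro i
    rw [← Finset.sum_erase univ (a := i) (by simp)]
    exact Finset.sum_congr rfl fun j hj => (if_neg (Finset.ne_of_mem_erase hj)).symm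
  intro i
  rw [hbase]
  ext k
  have hk := hsum k
  fin_cases i <;> simp only [Fin.sum_univ_five, Fin.reduceFinMk, Fin.zero_eta, Fin.mk_one,
    Fin.reduceEq, reduceIte, zero_ne_one, one_ne_zero, zero_add, add_zero, Fin.isValue,
    hswap 1 0, hswap 2 0, hswap 3 0, hswap 4 0, hswap 2 1, hswap 3 1, hswap 4 1, hswap 3 2,
    hswap 4 2, hswap 4 3, h01, h02, h03, h04, h12, h13, h14, h23, h24, h34, hsin, hm2, hm3, hm4,
    hbalance, Pi.add_apply, Pi.sub_apply, Pi.smul_apply, Pi.zero_apply, smul_eq_mul]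
  · linear_combination (m 0 * m 4 / r ^ 3) * hk
  · linear_combination (m 4 * m 4 / √(1 - d ^ 2) ^ 3) * (hk - q 1 k * hdc)
  · linear_combination (m 4 * m 4 / √(1 - d ^ 2) ^ 3) * (hk - q 2 k * hdc)
  · linear_combination (m 4 * m 4 / √(1 - d ^ 2) ^ 3) * (hk - q 3 k * hdc)
  · linear_combination (m 4 * m 4 / √(1 - d ^ 2) ^ 3) * (hk - q 4 k * hdc)
end
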